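/- Let μ be the product probability measure on spin configurations σ : ℤ × ℤ → Bool under which the spins at distinct sites are independent and each equals true or false with probability 1/2 each (the symmetric Bernoulli product measure). Then for μ-almost every σ, every cluster of σ is finite: for every x ∈ ℤ × ℤ, the connected component of x in the graph whose vertex set is {y ∈ ℤ × ℤ : σ y = σ x} and whose edges join nearest neighbors is a finite set. -/

import Mathlib

open MeasureTheory

/-- `x` and `y` are nearest neighbors in `ℤ × ℤ`. -/
def nbr (x y : ℤ × ℤ) : Prop := (x.1 - y.1).natAbs + (x.2 - y.2).natAbs = 1

/-- The cluster of the site `x` in the spin configuration `σ`: the connected component of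
`x` in the graph on the sites carrying the spin `σ x`, with edges between nearest
neighbors. -/
def cluster (σ : ℤ × ℤ → Bool) (x : ℤ × ℤ) : Set (ℤ × ℤ) :=
  {y | Relation.ReflTransGen (fun u v => nbr u v ∧ σ u = σ x ∧ σ v = σ x) x y}

namespace Perc

/-! ### Part A: the measure -/

/-- Spin configurations. -/
abbrev Cfg := (ℤ × ℤ) → Bool

/-- Cylinder event. -/
def cyl (F : Finset (ℤ × ℤ)) (η : Cfg) : Set Cfg := {σ | ∀ x ∈ F, σ x = η x}

/-- The cylinder probabilities of the fair Bernoulli product measure. -/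
def Fair (μ : Measure Cfg) : Prop :=
  ∀ (F : Finset (ℤ × ℤ)) (η : Cfg), μ (cyl F η) = (1 / 2 : ENNReal) ^ F.card

lemma measurableSet_coord (x : ℤ × ℤ) (b : Bool) : MeasurableSet {σ : Cfg | σ x = b} :=
  measurableSet_eq_fun (measurable_pi_apply x) measurable_const

lemma measurableSet_cyl (F : Finset (ℤ × ℤ)) (η : Cfg) : MeasurableSet (cyl F η) := by
  have : cyl F η = ⋂ x ∈ F, {σ : Cfg | σ x = η x} := by
    ext σ; simp [cyl]
  rw [this]
  exact Finset.measurableSet_biInter _ (fun x _ => measurableSet_coord x _)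

lemma ext_cyl (μ ν : Measure Cfg) [IsFiniteMeasure μ]
    (h : ∀ F η, μ (cyl F η) = ν (cyl F η)) : μ = ν := by
  refine ext_of_generate_finite {s | ∃ F η, s = cyl F η} ?_ ?_ ?_ ?_
  · apply le_antisymm
    · refine iSup_le fun x => ?_
      rw [← measurable_iff_comap_le]
      refine @measurable_to_bool _ (_) _ ?_
      apply MeasurableSpace.measurableSet_generateFrom
      refine ⟨{x}, fun _ => true, ?_⟩
      ext σ; simp [cyl]
    · apply MeasurableSpace.generateFrom_le
      rintro _ ⟨F, η, rfl⟩
      exact measurableSet_cyl F η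
  · rintro _ ⟨F, η, rfl⟩ _ ⟨F', η', rfl⟩ ⟨σ, h1, h2⟩
    refine ⟨F ∪ F', σ, ?_⟩
    ext τ
    simp only [cyl, Set.mem_inter_iff, Set.mem_ofPred_eq, Finset.mem_union] at *
    constructor
    · rintro ⟨h3, h4⟩ x (hx | hx)
      · rw [h3 x hx, h1 x hx]
      · rw [h4 x hx, h2 x hx]
    · intro h3
      exact ⟨fun x hx => by rw [h3 x (Or.inl hx), h1 x hx],
        fun x hx => by rw [h3 x (Or.inr hx), h2 x hx]⟩
  · rintro _ ⟨F, η, rfl⟩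
    exact h F η
  · have := h ∅ (fun _ => true)
    simpa [cyl] using this

/-- Relabelling of sites. -/
lemma map_sites (μ : Measure Cfg) [IsProbabilityMeasure μ] (hμ : Fair μ)
    (e : (ℤ × ℤ) ≃ (ℤ × ℤ)) : MeasurePreserving (fun σ : Cfg => fun v => σ (e v)) μ μ := by
  have hm : Measurable (fun σ : Cfg => fun v => σ (e v)) :=
    measurable_pi_lambda _ (fun v => measurable_pi_apply _)
  refine ⟨hm, ?_⟩
  haveI : IsFiniteMeasure (μ.map (fun σ : Cfg => fun v => σ (e v))) := by infer_instance
  refine ext_cyl _ _ fun F η => ?_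
  rw [Measure.map_apply hm (measurableSet_cyl F η), hμ F η]
  have : (fun σ : Cfg => fun v => σ (e v)) ⁻¹' cyl F η
      = cyl (F.map e.toEmbedding) (fun v => η (e.symm v)) := by
    ext σ
    simp only [cyl, Set.mem_preimage, Set.mem_ofPred_eq, Finset.mem_map_equiv]
    constructor
    · intro h x hx
      have := h _ hx
      rwa [e.apply_symm_apply] at this
    · intro h x hx
      have := h (e x) (by rwa [e.symm_apply_apply])
      rwa [e.symm_apply_apply] at this
  rw [this, hμ]
  simp

/-- Global spin flip. -/
lemma map_neg (μ : Measure Cfg) [IsProbabilityMeasure μ] (hμ : Fair μ) :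
    MeasurePreserving (fun σ : Cfg => fun v => !(σ v)) μ μ := by
  have hm : Measurable (fun σ : Cfg => fun v => !(σ v)) :=
    measurable_pi_lambda _ (fun v => (measurable_of_finite not).comp (measurable_pi_apply _))
  refine ⟨hm, ?_⟩
  refine ext_cyl _ _ fun F η => ?_
  rw [Measure.map_apply hm (measurableSet_cyl F η), hμ F η]
  have : (fun σ : Cfg => fun v => !(σ v)) ⁻¹' cyl F η
      = cyl F (fun v => !(η v)) := by
    ext σ
    simp only [cyl, Set.mem_preimage, Set.mem_ofPred_eq]
    refine forall₂_congr fun x _ => ?_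
    cases σ x <;> cases η x <;> simp
  rw [this, hμ]

/-- Flip the spin at one site. -/
def flipAt (x : ℤ × ℤ) (σ : Cfg) : Cfg := fun v => if v = x then !(σ v) else σ v

lemma flipAt_flipAt (x : ℤ × ℤ) (σ : Cfg) : flipAt x (flipAt x σ) = σ := by
  funext v
  by_cases h : v = x <;> simp [flipAt, h]

lemma measurable_flipAt (x : ℤ × ℤ) : Measurable (flipAt x) := by
  refine measurable_pi_lambda _ (fun v => ?_)
  by_cases h : v = x
  · simp only [flipAt, h, if_true]
    exact (measurable_of_finite not).comp (measurable_pi_apply _)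
  · simp only [flipAt, h, if_false]
    exact measurable_pi_apply _

/-- Flipping one spin, as a measurable equivalence. -/
def flipEquiv (x : ℤ × ℤ) : Cfg ≃ᵐ Cfg where
  toFun := flipAt x
  invFun := flipAt x
  left_inv := flipAt_flipAt x
  right_inv := flipAt_flipAt x
  measurable_toFun := measurable_flipAt x
  measurable_invFun := measurable_flipAt x

lemma map_flip (μ : Measure Cfg) [IsProbabilityMeasure μ] (hμ : Fair μ) (x : ℤ × ℤ) :
    MeasurePreserving (flipEquiv x) μ μ := by
  refine ⟨(flipEquiv x).measurable, ?_⟩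
  refine ext_cyl _ _ fun F η => ?_
  rw [MeasurableEquiv.map_apply, hμ F η]
  have : (flipEquiv x) ⁻¹' cyl F η = cyl F (flipAt x η) := by
    ext σ
    simp only [cyl, Set.mem_preimage, Set.mem_ofPred_eq]
    refine forall₂_congr fun y _ => ?_
    change flipAt x σ y = _ ↔ _
    by_cases h : y = x
    · simp only [flipAt, h, if_true]
      cases σ x <;> cases η x <;> simp
    · simp [flipAt, h]
  rw [this, hμ]

lemma measure_flip (μ : Measure Cfg) [IsProbabilityMeasure μ] (hμ : Fair μ) (x : ℤ × ℤ)
    (A : Set Cfg) : μ {σ | flipAt x σ ∈ A} = μ A :=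
  (map_flip μ hμ x).measure_preimage_equiv A

/-- An event invariant under flips in `F` is independent of the spins in `F`. -/
lemma indep_cyl (μ : Measure Cfg) [IsProbabilityMeasure μ] (hμ : Fair μ) (A : Set Cfg)
    (F : Finset (ℤ × ℤ)) (hA : ∀ x ∈ F, ∀ σ, σ ∈ A → flipAt x σ ∈ A) (η : Cfg) :
    μ (A ∩ cyl F η) = μ A * (1 / 2 : ENNReal) ^ F.card := by
  induction F using Finset.induction_on with
  | empty => simp [cyl]
  | insert x F hx ih =>
    have ih' := ih (fun y hy => hA y (Finset.mem_insert_of_mem hy))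
    set B := A ∩ cyl F η with hB
    have hBinv : ∀ σ, σ ∈ B → flipAt x σ ∈ B := by
      rintro σ ⟨h1, h2⟩
      refine ⟨hA x (Finset.mem_insert_self _ _) σ h1, fun y hy => ?_⟩
      have : y ≠ x := fun h => hx (h ▸ hy)
      simp [flipAt, this, h2 y hy]
    have h1 : A ∩ cyl (insert x F) η = B ∩ {σ | σ x = η x} := by
      ext σ
      simp only [hB, cyl, Set.mem_inter_iff, Set.mem_ofPred_eq, Finset.mem_insert, forall_eq_or_imp]
      tauto
    have h2 : μ (B ∩ {σ | σ x = η x}) = μ (B \ {σ | σ x = η x}) := by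
      rw [← measure_flip μ hμ x (B \ {σ | σ x = η x})]
      congr 1
      ext σ
      simp only [Set.mem_inter_iff, Set.mem_ofPred_eq, Set.mem_sdiff]
      have e1 : flipAt x σ x = !(σ x) := by simp [flipAt]
      rw [e1]
      constructor
      · rintro ⟨a, b⟩
        refine ⟨hBinv σ a, ?_⟩
        rw [b]; simp
      · rintro ⟨a, b⟩
        refine ⟨?_, ?_⟩
        · have := hBinv _ a
          rwa [flipAt_flipAt] at this
        · revert b
          cases σ x <;> cases η x <;> simp
    have h3 := measure_inter_add_sdiff (μ := μ) B (measurableSet_coord x (η x))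
    rw [← h2, ih'] at h3
    rw [h1, Finset.card_insert_of_notMem hx, pow_succ, ← mul_assoc, ← h3, ← two_mul,
      mul_comm (2 : ENNReal), mul_assoc]
    rw [one_div, ENNReal.mul_inv_cancel (by norm_num) (by norm_num), mul_one]

/-- Zero-one law. -/
lemma zero_one (μ : Measure Cfg) [IsProbabilityMeasure μ] (hμ : Fair μ) (A : Set Cfg)
    (hA : ∀ x, ∀ σ, σ ∈ A → flipAt x σ ∈ A) : μ A = 0 ∨ μ A = 1 := by
  have h : μ.restrict (toMeasurable μ A) = μ A • μ := by
    refine ext_cyl _ _ fun F η => ?_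
    rw [Measure.restrict_apply (measurableSet_cyl F η), Set.inter_comm,
      Measure.measure_toMeasurable_inter (measurableSet_cyl F η) (measure_ne_top _ _),
      indep_cyl μ hμ A F (fun x _ => hA x) η, Measure.smul_apply, hμ F η, smul_eq_mul]
  have h2 := congrArg (fun ν => ν (toMeasurable μ A)) h
  simp only [Measure.restrict_apply_self, Measure.smul_apply, measure_toMeasurable,
    smul_eq_mul] at h2
  by_cases h0 : μ A = 0
  · exact Or.inl h0
  · right
    have := (ENNReal.mul_right_inj h0 (measure_ne_top μ A)).1 (h2.symm.trans (mul_one (μ A)).symm)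
    exact this

/-- Dependence on finitely many spins. -/
def DependsOnFin (F : Finset (ℤ × ℤ)) (A : Set Cfg) : Prop :=
  ∀ σ τ : Cfg, (∀ x ∈ F, σ x = τ x) → σ ∈ A → τ ∈ A

/-- The configuration equal to `true` exactly on `s`. -/
def cfgOf {F : Finset (ℤ × ℤ)} (s : Finset F) : Cfg :=
  fun v => decide (∃ h : v ∈ F, (⟨v, h⟩ : F) ∈ s)

open Classical in
/-- The family of subsets of `F` coding an event. -/
noncomputable def fam (F : Finset (ℤ × ℤ)) (A : Set Cfg) : Finset (Finset F) :=
  Finset.univ.filter (fun s => cfgOf s ∈ A)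

lemma eq_iUnion_cyl {F : Finset (ℤ × ℤ)} {A : Set Cfg} (hA : DependsOnFin F A) :
    A = ⋃ s ∈ fam F A, cyl F (cfgOf s) := by
  classical
  ext σ
  simp only [Set.mem_iUnion, fam, Finset.mem_filter, Finset.mem_univ, true_and, exists_prop]
  constructor
  · intro h
    have key : ∀ x ∈ F, σ x
        = cfgOf (Finset.univ.filter (fun y : F => σ y.1 = true)) x := by
      intro x hx
      cases hs : σ x <;> simp [cfgOf, hx, hs]
    exact ⟨_, hA _ _ key h, key⟩
  · rintro ⟨s, h1, h2⟩
    exact hA _ _ (fun x hx => (h2 x hx).symm) h1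

lemma DependsOnFin.measurableSet {F : Finset (ℤ × ℤ)} {A : Set Cfg} (hA : DependsOnFin F A) :
    MeasurableSet A := by
  rw [eq_iUnion_cyl hA]
  exact Finset.measurableSet_biUnion _ (fun s _ => measurableSet_cyl _ _)

lemma measure_fam (μ : Measure Cfg) [IsProbabilityMeasure μ] (hμ : Fair μ)
    {F : Finset (ℤ × ℤ)} {A : Set Cfg} (hA : DependsOnFin F A) :
    μ A = ((fam F A).card : ENNReal) * (1 / 2 : ENNReal) ^ F.card := by
  conv_lhs => rw [eq_iUnion_cyl hA]
  rw [measure_biUnion_finset]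
  · simp [hμ F, cfgOf, Finset.sum_const]
  · intro s _ t _ hst
    rw [Function.onFun, Set.disjoint_left]
    intro σ h1 h2
    apply hst
    ext ⟨x, hx⟩
    have := (h1 x hx).symm.trans (h2 x hx)
    simpa [cfgOf, hx] using this
  · intro s _
    exact measurableSet_cyl _ _

/-- A decreasing event. -/
def Decr (A : Set Cfg) : Prop := ∀ σ τ : Cfg, (∀ x, τ x = true → σ x = true) → σ ∈ A → τ ∈ A

/-- Harris' inequality for decreasing events depending on finitely many spins. -/
lemma harris (μ : Measure Cfg) [IsProbabilityMeasure μ] (hμ : Fair μ)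
    {F : Finset (ℤ × ℤ)} {A B : Set Cfg} (hA : DependsOnFin F A) (hB : DependsOnFin F B)
    (dA : Decr A) (dB : Decr B) : μ A * μ B ≤ μ (A ∩ B) := by
  classical
  have hAB : DependsOnFin F (A ∩ B) := fun σ τ h hs => ⟨hA σ τ h hs.1, hB σ τ h hs.2⟩
  have low : ∀ C : Set Cfg, Decr C → IsLowerSet (fam F C : Set (Finset F)) := by
    intro C dC s t hts hs
    simp only [fam, Finset.coe_filter, Finset.mem_univ, true_and, Set.mem_ofPred_eq] at hs ⊢
    refine dC _ _ (fun x hx => ?_) hs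
    simp only [cfgOf, decide_eq_true_eq] at hx ⊢
    obtain ⟨h1, h2⟩ := hx
    exact ⟨h1, hts h2⟩
  have k := (low A dA).le_card_inter_finset (low B dB)
  have e : fam F A ∩ fam F B = fam F (A ∩ B) := by
    ext s; simp [fam]
  rw [e, Fintype.card_coe] at k
  rw [measure_fam μ hμ hA, measure_fam μ hμ hB, measure_fam μ hμ hAB]
  have k' : ((fam F A).card : ENNReal) * (fam F B).card
      ≤ 2 ^ F.card * (fam F (A ∩ B)).card := by exact_mod_cast k
  have h2 : (2 : ENNReal) ^ F.card * (1 / 2 : ENNReal) ^ F.card = 1 := by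
    rw [← mul_pow, one_div, ENNReal.mul_inv_cancel (by norm_num) (by norm_num), one_pow]
  calc _ = ((fam F A).card : ENNReal) * (fam F B).card
        * ((1 / 2 : ENNReal) ^ F.card * (1 / 2 : ENNReal) ^ F.card) := by ring
    _ ≤ (2 ^ F.card * (fam F (A ∩ B)).card)
        * ((1 / 2 : ENNReal) ^ F.card * (1 / 2 : ENNReal) ^ F.card) := by gcongr
    _ = (2 ^ F.card * (1 / 2 : ENNReal) ^ F.card)
        * ((fam F (A ∩ B)).card * (1 / 2 : ENNReal) ^ F.card) := by ring
    _ = _ := by rw [h2, one_mul]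

end Perc

namespace Perc

/-! ### Part B: connectivity and the counting lemma -/

lemma nbr_symm {x y : ℤ × ℤ} (h : nbr x y) : nbr y x := by
  unfold nbr at *; omega

/-- Connection inside a set of sites. -/
def Reach (S : Set (ℤ × ℤ)) (a b : ℤ × ℤ) : Prop :=
  Relation.ReflTransGen (fun u v => nbr u v ∧ u ∈ S ∧ v ∈ S) a b

lemma Reach.refl {S : Set (ℤ × ℤ)} {a : ℤ × ℤ} : Reach S a a := Relation.ReflTransGen.refl

lemma Reach.trans {S : Set (ℤ × ℤ)} {a b c : ℤ × ℤ} (h : Reach S a b) (h' : Reach S b c) :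
    Reach S a c := Relation.ReflTransGen.trans h h'

lemma Reach.step {S : Set (ℤ × ℤ)} {a b : ℤ × ℤ} (h : nbr a b) (ha : a ∈ S) (hb : b ∈ S) :
    Reach S a b := Relation.ReflTransGen.single ⟨h, ha, hb⟩

lemma Reach.inv {S : Set (ℤ × ℤ)} {a b : ℤ × ℤ} (h : Reach S a b) (P : ℤ × ℤ → Prop) (h0 : P a)
    (hs : ∀ u v, P u → nbr u v → u ∈ S → v ∈ S → P v) : P b := by
  unfold Reach at h
  induction h with
  | refl => exact h0
  | tail _ h2 ih => exact hs _ _ ih h2.1 h2.2.1 h2.2.2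

lemma Reach.symm {S : Set (ℤ × ℤ)} {a b : ℤ × ℤ} (h : Reach S a b) : Reach S b a :=
  h.inv (fun v => Reach S v a) Reach.refl
    (fun _ _ hu hn h1 h2 => (Reach.step (nbr_symm hn) h2 h1).trans hu)

lemma Reach.mem {S : Set (ℤ × ℤ)} {a b : ℤ × ℤ} (h : Reach S a b) (ha : a ∈ S) : b ∈ S :=
  h.inv (fun v => v ∈ S) ha (fun _ _ _ _ _ h2 => h2)

lemma Reach.restrict {S S' : Set (ℤ × ℤ)} {a b : ℤ × ℤ} (h : Reach S a b)
    (hS : ∀ w, Reach S a w → w ∈ S') : Reach S' a b :=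
  (h.inv (fun v => Reach S a v ∧ Reach S' a v) ⟨Reach.refl, Reach.refl⟩
    (fun u v hu hn h1 h2 => by
      have : Reach S a v := hu.1.trans (Reach.step hn h1 h2)
      exact ⟨this, hu.2.trans (Reach.step hn (hS _ hu.1) (hS _ this))⟩)).2

lemma Reach.mono {S S' : Set (ℤ × ℤ)} {a b : ℤ × ℤ} (h : Reach S a b) (hS : S ⊆ S') :
    Reach S' a b :=
  h.inv (fun v => Reach S' a v) Reach.refl
    (fun _ _ hu hn h1 h2 => hu.trans (Reach.step hn (hS h1) (hS h2)))

lemma Reach.map {S S' : Set (ℤ × ℤ)} {a b : ℤ × ℤ} (h : Reach S a b) (f : ℤ × ℤ → ℤ × ℤ)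
    (hf : ∀ u v, nbr u v → nbr (f u) (f v)) (hS : ∀ u ∈ S, f u ∈ S') : Reach S' (f a) (f b) :=
  h.inv (fun v => Reach S' (f a) (f v)) Reach.refl
    (fun _ _ hu hn h1 h2 => hu.trans (Reach.step (hf _ _ hn) (hS _ h1) (hS _ h2)))

/-- At most one branch of a trifurcation meets a connected set. -/
lemma branch_avoid {G S S' : Set (ℤ × ℤ)} (hS' : S' ⊆ G \ S)
    (hconn : ∀ u ∈ S', ∀ v ∈ S', Reach S' u v) {p q : ℤ × ℤ} (hpq : ¬ Reach (G \ S) p q) :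
    (∀ w, Reach (G \ S) p w → w ∉ S') ∨ (∀ w, Reach (G \ S) q w → w ∉ S') := by
  by_contra hcon
  push Not at hcon
  obtain ⟨⟨u, hu, hu'⟩, ⟨v, hv, hv'⟩⟩ := hcon
  exact hpq ((hu.trans ((hconn u hu' v hv').mono hS')).trans hv.symm)

/-- Burton–Keane counting: the number of trifurcations is at most the number of boundary points. -/
lemma counting {ι : Type*} (G : Set (ℤ × ℤ)) (hG : G.Finite)
    (S : ι → Set (ℤ × ℤ)) (a : ι → Fin 3 → ℤ × ℤ) (n : ℕ) :
    ∀ (T : Finset ι) (Y : Finset (ℤ × ℤ)), T.card = n →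
    (∀ t ∈ T, S t ⊆ G) →
    (∀ t ∈ T, ∀ u ∈ S t, ∀ v ∈ S t, Reach (S t) u v) →
    (∀ t ∈ T, ∀ t' ∈ T, t ≠ t' → Disjoint (S t) (S t')) →
    (∀ t ∈ T, ∀ i, a t i ∈ G \ S t) →
    (∀ t ∈ T, ∀ i, ∃ s ∈ S t, nbr s (a t i)) →
    (∀ t ∈ T, ∀ i j, i ≠ j → ¬ Reach (G \ S t) (a t i) (a t j)) →
    (∀ t ∈ T, ∀ i, ∃ y ∈ Y, Reach (G \ S t) (a t i) y) →
    T.card ≤ Y.card := by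
  classical
  induction n with
  | zero => intro T Y hT _ _ _ _ _ _ _; omega
  | succ n ih =>
    intro T Y hT hS hconn hdis ha hadj hsep hY
    set B : ι → Fin 3 → Set (ℤ × ℤ) := fun t i => {v | Reach (G \ S t) (a t i) v} with hB
    have hTne : T.Nonempty := by rw [← Finset.card_pos]; omega
    obtain ⟨⟨t, i⟩, hti, hmin⟩ := Finset.exists_min_image (T ×ˢ (Finset.univ : Finset (Fin 3)))
      (fun p => (B p.1 p.2).ncard) (hTne.product Finset.univ_nonempty)
    have ht : t ∈ T := (Finset.mem_product.1 hti).1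
    have hfin : (B t i).Finite := hG.subset fun v hv => (hv.mem (ha t ht i)).1
    have hsub : ∀ t1 ∈ T, ∀ t2 ∈ T, t1 ≠ t2 → S t1 ⊆ G \ S t2 := by
      intro t1 h1 t2 h2 hne v hv
      exact ⟨hS t1 h1 hv, Set.disjoint_left.1 (hdis t1 h1 t2 h2 hne) hv⟩
    -- no other trifurcation in the minimal branch
    have claim1 : ∀ t' ∈ T, t' ≠ t → ∀ w, Reach (G \ S t) (a t i) w → w ∉ S t' := by
      intro t' ht' hne s hs hs'
      have hl : ∃ l, ∀ w, Reach (G \ S t') (a t' l) w → w ∉ S t := by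
        rcases branch_avoid (hsub t ht t' ht' hne.symm) (hconn t ht)
          (hsep t' ht' 0 1 (by decide)) with h | h
        · exact ⟨0, h⟩
        · exact ⟨1, h⟩
      obtain ⟨l, hl⟩ := hl
      obtain ⟨s', hs1, hs2⟩ := hadj t' ht' l
      have hGa : a t' l ∈ G \ S t := ⟨(ha t' ht' l).1, hl _ Reach.refl⟩
      have hss : B t' l ⊂ B t i := by
        refine ⟨fun v hv => ?_, fun hcon => ?_⟩
        · have h1 : Reach (G \ S t) (a t' l) v := Reach.restrict hv
            (fun w hw => ⟨(hw.mem (ha t' ht' l)).1, hl w hw⟩)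
          have h2 : Reach (G \ S t) s s' := (hconn t' ht' s hs' s' hs1).mono (hsub t' ht' t ht hne)
          exact ((hs.trans h2).trans
            (Reach.step hs2 (hsub t' ht' t ht hne hs1) hGa)).trans h1
        · have : s ∈ B t' l := hcon hs
          exact (Reach.mem this (ha t' ht' l)).2 hs'
      have h1 := Set.ncard_lt_ncard hss hfin
      have h2 := hmin (t', l) (Finset.mem_product.2 ⟨ht', Finset.mem_univ _⟩)
      simp only at h2
      omega
    have hcard : (T.erase t).card = n := by rw [Finset.card_erase_of_mem ht]; omega
    have hsubT : ∀ t', t' ∈ T.erase t → t' ∈ T := fun t' h => (Finset.mem_erase.1 h).2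
    have key := ih (T.erase t) (Y.filter (fun y => y ∉ B t i)) hcard
      (fun t' h => hS t' (hsubT t' h)) (fun t' h => hconn t' (hsubT t' h))
      (fun t1 h1 t2 h2 => hdis t1 (hsubT t1 h1) t2 (hsubT t2 h2))
      (fun t' h => ha t' (hsubT t' h)) (fun t' h => hadj t' (hsubT t' h))
      (fun t' h => hsep t' (hsubT t' h)) (by
        intro t' h l
        have ht' := hsubT t' h
        have hne : t' ≠ t := (Finset.mem_erase.1 h).1
        obtain ⟨y, hy, hyr⟩ := hY t' ht' l
        by_cases hyB : y ∈ B t i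
        swap
        · exact ⟨y, Finset.mem_filter.2 ⟨hy, hyB⟩, hyr⟩
        have h1 : Reach (G \ S t') (a t i) y := Reach.restrict hyB
          (fun w hw => ⟨(hw.mem (ha t ht i)).1, claim1 t' ht' hne w hw⟩)
        obtain ⟨s, hs1, hs2⟩ := hadj t ht i
        have hai : a t i ∈ G \ S t' := ⟨(ha t ht i).1, claim1 t' ht' hne _ Reach.refl⟩
        have h2 : Reach (G \ S t') (a t' l) s := (hyr.trans h1.symm).trans
          (Reach.step (nbr_symm hs2) hai (hsub t ht t' ht' hne.symm hs1))
        have hj : ∃ j, i ≠ j ∧ ∀ w, Reach (G \ S t) (a t j) w → w ∉ S t' := by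
          have hd : i + 1 ≠ i + 2 := by clear * -; revert i; decide
          rcases branch_avoid (hsub t' ht' t ht hne) (hconn t' ht')
            (hsep t ht (i+1) (i+2) hd) with h | h
          · exact ⟨i+1, by clear * -; revert i; decide, h⟩
          · exact ⟨i+2, by clear * -; revert i; decide, h⟩
        obtain ⟨j, hij, hj⟩ := hj
        obtain ⟨y', hy', hyr'⟩ := hY t ht j
        obtain ⟨s', hs1', hs2'⟩ := hadj t ht j
        have h3 : Reach (G \ S t') (a t j) y' := hyr'.restrict
          (fun w hw => ⟨(hw.mem (ha t ht j)).1, hj w hw⟩)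
        have haj : a t j ∈ G \ S t' := ⟨(ha t ht j).1, hj _ Reach.refl⟩
        refine ⟨y', Finset.mem_filter.2 ⟨hy', fun hc => ?_⟩, ?_⟩
        · exact hsep t ht i j hij (Reach.trans hc hyr'.symm)
        · exact ((h2.trans ((hconn t ht s hs1 s' hs1').mono (hsub t ht t' ht' hne.symm))).trans
            (Reach.step hs2' (hsub t ht t' ht' hne.symm hs1') haj)).trans h3)
    obtain ⟨y, hy, hyr⟩ := hY t ht i
    have hlt : (Y.filter (fun y => y ∉ B t i)).card < Y.card := by
      apply Finset.card_lt_card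
      rw [Finset.filter_ssubset]
      exact ⟨y, hy, fun h => h hyr⟩
    omega

end Perc

namespace Perc

/-! ### Part C: planarity via mod 2 chains -/

/-- Indicator with values in `ZMod 2`. -/
noncomputable def ind (p : Prop) : ZMod 2 := by classical exact if p then 1 else 0

lemma ind_true {p : Prop} (h : p) : ind p = 1 := by simp [ind, h]
lemma ind_false {p : Prop} (h : ¬ p) : ind p = 0 := by simp [ind, h]

lemma nbr_cases {x y x' y' : ℤ} (h : nbr (x, y) (x', y')) :
    (x' = x + 1 ∧ y' = y) ∨ (x = x' + 1 ∧ y' = y) ∨ (x' = x ∧ y' = y + 1) ∨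
      (x' = x ∧ y = y' + 1) := by
  unfold nbr at h
  simp only at h
  omega

lemma z2_self (a : ZMod 2) : a + a = 0 := by revert a; decide

/-- A connection carries a mod 2 chain. -/
lemma chain (A : Set (ℤ × ℤ)) (a b : ℤ × ℤ) (h : Reach A a b) :
    ∃ V H : ℤ → ℤ → ZMod 2, (∀ x y, V x y ≠ 0 → (x, y) ∈ A ∧ (x, y + 1) ∈ A) ∧
      (∀ x y, H x y ≠ 0 → (x, y) ∈ A ∧ (x + 1, y) ∈ A) ∧
      ∀ x y, V x y + V x (y - 1) + H x y + H (x - 1) y = ind ((x, y) = a) + ind ((x, y) = b) := by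
  refine h.inv (fun b => ∃ V H : ℤ → ℤ → ZMod 2,
      (∀ x y, V x y ≠ 0 → (x, y) ∈ A ∧ (x, y + 1) ∈ A) ∧
      (∀ x y, H x y ≠ 0 → (x, y) ∈ A ∧ (x + 1, y) ∈ A) ∧
      ∀ x y, V x y + V x (y - 1) + H x y + H (x - 1) y
        = ind ((x, y) = a) + ind ((x, y) = b)) ?_ ?_
  · refine ⟨fun _ _ => 0, fun _ _ => 0, by simp, by simp, fun x y => ?_⟩
    rw [z2_self (ind ((x, y) = a))]; simp
  · rintro ⟨x0, y0⟩ ⟨x1, y1⟩ ⟨V, H, hV, hH, hd⟩ hn hu hv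
    -- it suffices to add one edge
    have vert : ∀ p q : ℤ, (p, q) ∈ A → (p, q + 1) ∈ A →
        (∀ x y : ℤ, ind ((x, y) = (x1, y1)) = ind ((x, y) = (x0, y0)) +
          (ind (x = p ∧ y = q) + ind (x = p ∧ y = q + 1))) →
        ∃ V H : ℤ → ℤ → ZMod 2,
      (∀ x y, V x y ≠ 0 → (x, y) ∈ A ∧ (x, y + 1) ∈ A) ∧
      (∀ x y, H x y ≠ 0 → (x, y) ∈ A ∧ (x + 1, y) ∈ A) ∧
      ∀ x y, V x y + V x (y - 1) + H x y + H (x - 1) y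
        = ind ((x, y) = a) + ind ((x, y) = (x1, y1)) := by
      intro p q h1 h2 he
      refine ⟨fun x y => V x y + ind (x = p ∧ y = q), H, fun x y hne => ?_, hH, fun x y => ?_⟩
      · simp only at hne
        by_cases hc : x = p ∧ y = q
        · obtain ⟨rfl, rfl⟩ := hc
          exact ⟨h1, h2⟩
        · rw [ind_false hc, add_zero] at hne
          exact hV x y hne
      · have e : ind (x = p ∧ y - 1 = q) = ind (x = p ∧ y = q + 1) := by
          congr 1; simp only [eq_iff_iff]; omega
        simp only
        rw [he, e, ← add_assoc (ind ((x, y) = a)), ← hd]; ring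
    have hori : ∀ p q : ℤ, (p, q) ∈ A → (p + 1, q) ∈ A →
        (∀ x y : ℤ, ind ((x, y) = (x1, y1)) = ind ((x, y) = (x0, y0)) +
          (ind (x = p ∧ y = q) + ind (x = p + 1 ∧ y = q))) →
        ∃ V H : ℤ → ℤ → ZMod 2,
      (∀ x y, V x y ≠ 0 → (x, y) ∈ A ∧ (x, y + 1) ∈ A) ∧
      (∀ x y, H x y ≠ 0 → (x, y) ∈ A ∧ (x + 1, y) ∈ A) ∧
      ∀ x y, V x y + V x (y - 1) + H x y + H (x - 1) y
        = ind ((x, y) = a) + ind ((x, y) = (x1, y1)) := by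
      intro p q h1 h2 he
      refine ⟨V, fun x y => H x y + ind (x = p ∧ y = q), hV, fun x y hne => ?_, fun x y => ?_⟩
      · simp only at hne
        by_cases hc : x = p ∧ y = q
        · obtain ⟨rfl, rfl⟩ := hc
          exact ⟨h1, h2⟩
        · rw [ind_false hc, add_zero] at hne
          exact hH x y hne
      · have e : ind (x - 1 = p ∧ y = q) = ind (x = p + 1 ∧ y = q) := by
          congr 1; simp only [eq_iff_iff]; omega
        simp only
        rw [he, e, ← add_assoc (ind ((x, y) = a)), ← hd]; ring
    have z : ∀ a b : ZMod 2, a = b + (b + a) := by decide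
    have z' : ∀ a b : ZMod 2, a = b + (a + b) := by decide
    rcases nbr_cases hn with ⟨rfl, rfl⟩ | ⟨rfl, rfl⟩ | ⟨rfl, rfl⟩ | ⟨rfl, rfl⟩
    · exact hori x0 y1 hu hv (fun x y => by simp only [Prod.mk.injEq]; exact z _ _)
    · exact hori x1 y1 hv hu (fun x y => by simp only [Prod.mk.injEq]; exact z' _ _)
    · exact vert x1 y0 hu hv (fun x y => by simp only [Prod.mk.injEq]; exact z _ _)
    · exact vert x1 y1 hv hu (fun x y => by simp only [Prod.mk.injEq]; exact z' _ _)

/-- A mod 2 cycle has a mod 2 winding function. -/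
lemma winding (L : Set (ℤ × ℤ)) (M : ℤ)
    (hL : ∀ x y, (x, y) ∈ L → -M < x ∧ x < M ∧ -M < y ∧ y < M) (V H : ℤ → ℤ → ZMod 2)
    (hV : ∀ x y, V x y ≠ 0 → (x, y) ∈ L ∧ (x, y + 1) ∈ L)
    (hH : ∀ x y, H x y ≠ 0 → (x, y) ∈ L ∧ (x + 1, y) ∈ L)
    (hd : ∀ x y, V x y + V x (y - 1) + H x y + H (x - 1) y = 0) :
    ∃ f : ℤ → ℤ → ZMod 2, (∀ x y, f (x - 1) y = f x y + V x y) ∧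
      (∀ x y, f x y = f x (y - 1) + H x y) ∧
      ∀ u w : ℤ × ℤ, Reach Lᶜ u w → (w.1 ≤ -M ∨ M ≤ w.1 ∨ w.2 ≤ -M ∨ M ≤ w.2) → f u.1 u.2 = 0 := by
  have hV0 : ∀ x y, (x, y) ∉ L → V x y = 0 := fun x y h => by
    by_contra hc; exact h (hV x y hc).1
  have hH0 : ∀ x y, (x, y) ∉ L → H x y = 0 := fun x y h => by
    by_contra hc; exact h (hH x y hc).1
  set f : ℤ → ℤ → ZMod 2 := fun a y => ∑ x ∈ Finset.Ioc a M, V x y with hf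
  have f1 : ∀ x y, f (x - 1) y = f x y + V x y := by
    intro x y
    by_cases hx : x ≤ M
    · have : Finset.Ioc (x - 1) M = insert x (Finset.Ioc x M) := by
        ext z; simp only [Finset.mem_Ioc, Finset.mem_insert]; omega
      simp only [hf]
      rw [this, Finset.sum_insert (by simp), add_comm]
    · have e1 : Finset.Ioc (x - 1) M = ∅ := Finset.Ioc_eq_empty (by omega)
      have e2 : Finset.Ioc x M = ∅ := Finset.Ioc_eq_empty (by omega)
      simp only [hf, e1, e2, Finset.sum_empty, zero_add]
      rw [hV0]; intro h; have := hL _ _ h; omega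
  have fr : ∀ x y, M ≤ x → f x y = 0 := by
    intro x y hx
    simp [hf, Finset.Ioc_eq_empty (show ¬ x < M by omega)]
  have f2' : ∀ n : ℕ, ∀ x y, M - n ≤ x → f x y = f x (y - 1) + H x y := by
    intro n
    induction n with
    | zero =>
      intro x y hx
      rw [fr x y (by simpa using hx), fr x (y-1) (by simpa using hx), hH0]
      · simp
      · intro h; have := hL _ _ h; push_cast at hx; omega
    | succ n ih =>
      intro x y hx
      have h1 := ih (x + 1) y (by push_cast at hx; omega)
      have h2 := f1 (x + 1) y
      have h3 := f1 (x + 1) (y - 1)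
      have h4 := hd (x + 1) y
      rw [add_sub_cancel_right] at h2 h3 h4
      rw [h2, h3, h1]
      generalize f (x + 1) (y - 1) = a at *
      generalize H (x + 1) y = b at *
      generalize V (x + 1) y = c at *
      generalize V (x + 1) (y - 1) = d at *
      generalize H x y = e at *
      clear * - h4
      revert a b c d e; decide
  have f2 : ∀ x y, f x y = f x (y - 1) + H x y := by
    intro x y
    exact f2' (M - x).toNat x y (by omega)
  have ft : ∀ x y, (y ≤ -M ∨ M ≤ y) → f x y = 0 := by
    intro x y hy
    refine Finset.sum_eq_zero fun z _ => hV0 _ _ fun h => ?_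
    have := hL _ _ h; omega
  have fl : ∀ x y, x ≤ -M → f x y = 0 := by
    intro x y hx
    have : ∀ n : ℕ, ∀ y, y ≤ -M + n → f x y = 0 := by
      intro n
      induction n with
      | zero => intro y hy; exact ft x y (by left; simpa using hy)
      | succ n ih =>
        intro y hy
        rw [f2, ih (y - 1) (by push_cast at hy; omega), hH0, add_zero]
        intro h; have := hL _ _ h; omega
    exact this (y + M).toNat y (by omega)
  refine ⟨f, f1, f2, ?_⟩
  intro u w h hw
  have hconst : f u.1 u.2 = f w.1 w.2 := by
    refine h.inv (fun w => f u.1 u.2 = f w.1 w.2) rfl ?_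
    rintro ⟨x0, y0⟩ ⟨x1, y1⟩ hp hn hu hv
    rw [hp]
    simp only
    rcases nbr_cases hn with ⟨rfl, rfl⟩ | ⟨rfl, rfl⟩ | ⟨rfl, rfl⟩ | ⟨rfl, rfl⟩
    · have := f1 (x0 + 1) y1
      rw [add_sub_cancel_right, hV0 _ _ hv, add_zero] at this
      exact this
    · have := f1 (x1 + 1) y1
      rw [add_sub_cancel_right, hV0 _ _ hu, add_zero] at this
      exact this.symm
    · have := f2 x1 (y0 + 1)
      rw [add_sub_cancel_right, hH0 _ _ hv, add_zero] at this
      exact this.symm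
    · have := f2 x1 (y1 + 1)
      rw [add_sub_cancel_right, hH0 _ _ hu, add_zero] at this
      exact this
  rw [hconst]
  rcases hw with h | h | h | h
  · exact fl _ _ h
  · exact fr _ _ h
  · exact ft _ _ (Or.inl h)
  · exact ft _ _ (Or.inr h)

/-- The box with center the origin. -/
def bx (m : ℤ) : Set (ℤ × ℤ) := {v | -m ≤ v.1 ∧ v.1 ≤ m ∧ -m ≤ v.2 ∧ v.2 ≤ m}

/-- Far away sites. -/
def far (M : ℤ) (w : ℤ × ℤ) : Prop := w.1 ≤ -M ∨ M ≤ w.1 ∨ w.2 ≤ -M ∨ M ≤ w.2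

/-- Combine an outer connection with an explicit inner path. -/
lemma loop (A : Set (ℤ × ℤ)) (m M : ℤ) (hm : m < M)
    (hA : ∀ v ∈ A, v ∉ bx m ∧ ¬ far M v) (s t : ℤ × ℤ) (h : Reach A s t)
    (Vi Hi : ℤ → ℤ → ZMod 2)
    (hV : ∀ x y, Vi x y ≠ 0 → (x, y) ∈ A ∪ bx m ∧ (x, y + 1) ∈ A ∪ bx m)
    (hH : ∀ x y, Hi x y ≠ 0 → (x, y) ∈ A ∪ bx m ∧ (x + 1, y) ∈ A ∪ bx m)
    (hd : ∀ x y, Vi x y + Vi x (y - 1) + Hi x y + Hi (x - 1) y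
      = ind ((x, y) = s) + ind ((x, y) = t)) :
    ∃ f : ℤ → ℤ → ZMod 2, (∀ x y, ((x, y) ∉ A ∨ (x, y + 1) ∉ A) → f (x - 1) y = f x y + Vi x y) ∧
      (∀ x y, ((x, y) ∉ A ∨ (x + 1, y) ∉ A) → f x y = f x (y - 1) + Hi x y) ∧
      ∀ u w : ℤ × ℤ, Reach (A ∪ bx m)ᶜ u w → far M w → f u.1 u.2 = 0 := by
  obtain ⟨V, H, h1, h2, h3⟩ := chain A s t h
  obtain ⟨f, f1, f2, f3⟩ := winding (A ∪ bx m) M (by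
      rintro x y (h | h)
      · have := (hA _ h).2
        simp only [far] at this; omega
      · simp only [bx, Set.mem_ofPred_eq] at h; omega)
    (fun x y => V x y + Vi x y) (fun x y => H x y + Hi x y) (by
      intro x y hne
      by_cases h0 : Vi x y = 0
      · simp only [h0, add_zero] at hne
        exact ⟨Or.inl (h1 x y hne).1, Or.inl (h1 x y hne).2⟩
      · exact hV x y h0) (by
      intro x y hne
      by_cases h0 : Hi x y = 0
      · simp only [h0, add_zero] at hne
        exact ⟨Or.inl (h2 x y hne).1, Or.inl (h2 x y hne).2⟩
      · exact hH x y h0) (by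
      intro x y
      have e1 := h3 x y
      have e2 := hd x y
      have e3 := z2_self (ind ((x, y) = s) + ind ((x, y) = t))
      nth_rewrite 1 [← e1] at e3
      rw [← e2] at e3
      rw [← e3]; ring)
  refine ⟨f, fun x y hxy => ?_, fun x y hxy => ?_, f3⟩
  · rw [f1]
    have : V x y = 0 := by
      by_contra hc; have := h1 x y hc; tauto
    rw [this, zero_add]
  · rw [f2]
    have : H x y = 0 := by
      by_contra hc; have := h2 x y hc; tauto
    rw [this, zero_add]

/-- Downward induction along a segment. -/
lemma down (g : ℤ → ZMod 2) (a b : ℤ) (h : ∀ k, a < k → k ≤ b → g (k - 1) = g k) :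
    ∀ k, a ≤ k → k ≤ b → g k = g b := by
  have : ∀ n : ℕ, ∀ k, k = b - n → a ≤ k → g k = g b := by
    intro n
    induction n with
    | zero => intro k hk _; rw [hk]; simp
    | succ n ih =>
      intro k hk ha
      have := h (k + 1) (by omega) (by push_cast at hk; omega)
      rw [add_sub_cancel_right] at this
      rw [this]
      exact ih (k + 1) (by push_cast at hk; omega) (by omega)
  intro k h1 h2
  exact this (b - k).toNat k (by omega) h1

lemma sep_side (A : Set (ℤ × ℤ)) (m M : ℤ) (hm0 : 0 ≤ m) (hm : m < M)
    (hA : ∀ v ∈ A, v ∉ bx m ∧ ¬ far M v) (y1 x2 x3 yL : ℤ) (hy1 : -m ≤ y1 ∧ y1 ≤ m)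
    (hx2 : -m ≤ x2 ∧ x2 ≤ 0) (hx3 : 0 ≤ x3 ∧ x3 ≤ m) (hyL : -m ≤ yL ∧ yL ≤ m)
    (hs : (m + 1, y1) ∈ A) (ht : (x2, m + 1) ∈ A) (hu : (x3, m + 1) ∉ A)
    (h3 : ∃ w, Reach (A ∪ bx m)ᶜ (x3, m + 1) w ∧ far M w)
    (hL : ∃ w, Reach (A ∪ bx m)ᶜ (-m - 1, yL) w ∧ far M w) :
    ¬ Reach A (m + 1, y1) (x2, m + 1) := by
  intro h
  obtain ⟨f, f1, f2, f3⟩ := loop A m M hm hA _ _ h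
    (fun x y => ind (x = x2 ∧ y1 ≤ y ∧ y ≤ m)) (fun x y => ind (y = y1 ∧ x2 ≤ x ∧ x ≤ m))
    (by
      intro x y hne
      have hc : x = x2 ∧ y1 ≤ y ∧ y ≤ m := by
        by_contra hc; exact hne (ind_false hc)
      obtain ⟨rfl, hc⟩ := hc
      refine ⟨Or.inr ?_, ?_⟩
      · simp only [bx, Set.mem_ofPred_eq]; omega
      · by_cases hy : y = m
        · left; rw [hy]; exact ht
        · right; simp only [bx, Set.mem_ofPred_eq]; omega)
    (by
      intro x y hne
      have hc : y = y1 ∧ x2 ≤ x ∧ x ≤ m := by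
        by_contra hc; exact hne (ind_false hc)
      obtain ⟨rfl, hc⟩ := hc
      refine ⟨Or.inr ?_, ?_⟩
      · simp only [bx, Set.mem_ofPred_eq]; omega
      · by_cases hy : x = m
        · left; rw [hy]; exact hs
        · right; simp only [bx, Set.mem_ofPred_eq]; omega)
    (by
      intro x y
      simp only [ind, Prod.mk.injEq]
      split_ifs <;> first | omega | decide)
  have nb : ∀ x y, -m ≤ x → x ≤ m → -m ≤ y → y ≤ m → (x, y) ∉ A := by
    intro x y _ _ _ _ hc
    apply (hA _ hc).1
    simp only [bx, Set.mem_ofPred_eq]; omega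
  have row : ∀ y, -m ≤ y → y ≤ m → ∀ k, -m - 1 ≤ k → k ≤ m →
      f k y = f m y + ind (k < x2 ∧ y1 ≤ y) := by
    intro y hy1 hy2 k hk1 hk2
    have := down (fun k => f k y + ind (k < x2 ∧ y1 ≤ y)) (-m - 1) m (by
      intro k hk1 hk2
      rw [f1 k y (Or.inl (nb k y (by omega) hk2 hy1 hy2))]
      generalize f k y = a
      simp only [ind]
      split_ifs <;> first | omega | (revert a; decide)) k hk1 hk2
    rw [ind_false (p := m < x2 ∧ y1 ≤ y) (by omega), add_zero] at this
    rw [← this, add_assoc, z2_self, add_zero]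
  have col : ∀ y, -m ≤ y → y ≤ m → f m y = f m m + ind (y < y1) := by
    intro y hy1 hy2
    have := down (fun y => f m y + ind (y < y1)) (-m) m (by
      intro k hk1 hk2
      rw [f2 m k (Or.inl (nb m k (by omega) (by omega) (by omega) hk2))]
      generalize f m (k - 1) = a
      simp only [ind]
      split_ifs <;> first | omega | (revert a; decide)) y hy1 hy2
    rw [ind_false (p := m < y1) (by omega), add_zero] at this
    rw [← this, add_assoc, z2_self, add_zero]
  obtain ⟨w3, hw3, hf3⟩ := h3
  obtain ⟨wL, hwL, hfL⟩ := hL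
  have e3 := f3 _ _ hw3 hf3
  have eL := f3 _ _ hwL hfL
  simp only at e3 eL
  rw [f2 x3 (m + 1) (Or.inl hu), add_sub_cancel_right, ind_false (by omega), add_zero,
    row m (by omega) (by omega) x3 (by omega) (by omega), ind_false (by omega), add_zero] at e3
  rw [row yL (by omega) (by omega) _ (by omega) (by omega), col yL (by omega) (by omega), e3] at eL
  revert eL
  simp only [ind]
  split_ifs <;> first | omega | decide

lemma sep_vert (A : Set (ℤ × ℤ)) (m M : ℤ) (hm0 : 0 ≤ m) (hm : m < M)
    (hA : ∀ v ∈ A, v ∉ bx m ∧ ¬ far M v) (x2 x3 x5 yL : ℤ)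
    (hx2 : -m ≤ x2 ∧ x2 ≤ 0) (hx3 : 0 ≤ x3 ∧ x3 ≤ m) (hx5 : -m ≤ x5 ∧ x5 ≤ 0)
    (hyL : -m ≤ yL ∧ yL ≤ m)
    (hs : (x2, m + 1) ∈ A) (ht : (x5, -m - 1) ∈ A) (hu : (x3, m + 1) ∉ A)
    (h3 : ∃ w, Reach (A ∪ bx m)ᶜ (x3, m + 1) w ∧ far M w)
    (hL : ∃ w, Reach (A ∪ bx m)ᶜ (-m - 1, yL) w ∧ far M w) :
    ¬ Reach A (x2, m + 1) (x5, -m - 1) := by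
  intro h
  obtain ⟨f, f1, f2, f3⟩ := loop A m M hm hA _ _ h
    (fun x y => ind (x = x2 ∧ 0 ≤ y ∧ y ≤ m) + ind (x = x5 ∧ -m - 1 ≤ y ∧ y < 0))
    (fun x y => ind (y = 0 ∧ ((x2 ≤ x ∧ x < x5) ∨ (x5 ≤ x ∧ x < x2))))
    (by
      intro x y hne
      have hc : (x = x2 ∧ 0 ≤ y ∧ y ≤ m) ∨ (x = x5 ∧ -m - 1 ≤ y ∧ y < 0) := by
        by_contra hc
        push Not at hc
        apply hne
        rw [ind_false (by omega), ind_false (by omega), add_zero]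
      rcases hc with ⟨rfl, hc⟩ | ⟨rfl, hc⟩
      · refine ⟨Or.inr ?_, ?_⟩
        · simp only [bx, Set.mem_ofPred_eq]; omega
        · by_cases hy : y = m
          · left; rw [hy]; exact hs
          · right; simp only [bx, Set.mem_ofPred_eq]; omega
      · refine ⟨?_, Or.inr ?_⟩
        · by_cases hy : y = -m - 1
          · left; rw [hy]; exact ht
          · right; simp only [bx, Set.mem_ofPred_eq]; omega
        · simp only [bx, Set.mem_ofPred_eq]; omega)
    (by
      intro x y hne
      have hc : y = 0 ∧ ((x2 ≤ x ∧ x < x5) ∨ (x5 ≤ x ∧ x < x2)) := by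
        by_contra hc; exact hne (ind_false hc)
      refine ⟨Or.inr ?_, Or.inr ?_⟩ <;>
      · simp only [bx, Set.mem_ofPred_eq]; omega)
    (by
      intro x y
      simp only [ind, Prod.mk.injEq]
      split_ifs <;> first | omega | decide)
  have nb : ∀ x y, -m ≤ x → x ≤ m → -m ≤ y → y ≤ m → (x, y) ∉ A := by
    intro x y _ _ _ _ hc
    apply (hA _ hc).1
    simp only [bx, Set.mem_ofPred_eq]; omega
  have row : ∀ y, -m ≤ y → y ≤ m → ∀ k, -m - 1 ≤ k → k ≤ m →
      f k y = f m y + ind ((0 ≤ y ∧ k < x2) ∨ (y < 0 ∧ k < x5)) := by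
    intro y hy1 hy2 k hk1 hk2
    have := down (fun k => f k y + ind ((0 ≤ y ∧ k < x2) ∨ (y < 0 ∧ k < x5))) (-m - 1) m (by
      intro k hk1 hk2
      rw [f1 k y (Or.inl (nb k y (by omega) hk2 hy1 hy2))]
      generalize f k y = a
      simp only [ind]
      split_ifs <;> first | omega | (revert a; decide)) k hk1 hk2
    rw [ind_false (p := (0 ≤ y ∧ m < x2) ∨ (y < 0 ∧ m < x5)) (by omega), add_zero] at this
    rw [← this, add_assoc, z2_self, add_zero]
  have col : ∀ y, -m ≤ y → y ≤ m → f m y = f m m := by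
    intro y hy1 hy2
    exact down (fun y => f m y) (-m) m (by
      intro k hk1 hk2
      rw [f2 m k (Or.inl (nb m k (by omega) (by omega) (by omega) hk2)), ind_false (by omega),
        add_zero]) y hy1 hy2
  obtain ⟨w3, hw3, hf3⟩ := h3
  obtain ⟨wL, hwL, hfL⟩ := hL
  have e3 := f3 _ _ hw3 hf3
  have eL := f3 _ _ hwL hfL
  simp only at e3 eL
  rw [f2 x3 (m + 1) (Or.inl hu), add_sub_cancel_right, ind_false (by omega), add_zero,
    row m (by omega) (by omega) x3 (by omega) (by omega), ind_false (by omega), add_zero] at e3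
  rw [row yL (by omega) (by omega) _ (by omega) (by omega), col yL (by omega) (by omega), e3,
    ind_true (by omega)] at eL
  revert eL
  decide

/-- Reflected version of `sep_side`. -/
lemma sep_side' (A : Set (ℤ × ℤ)) (m M : ℤ) (hm0 : 0 ≤ m) (hm : m < M)
    (hA : ∀ v ∈ A, v ∉ bx m ∧ ¬ far M v) (y1 x5 x6 yL : ℤ) (hy1 : -m ≤ y1 ∧ y1 ≤ m)
    (hx5 : -m ≤ x5 ∧ x5 ≤ 0) (hx6 : 0 ≤ x6 ∧ x6 ≤ m) (hyL : -m ≤ yL ∧ yL ≤ m)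
    (hs : (m + 1, y1) ∈ A) (ht : (x5, -m - 1) ∈ A) (hu : (x6, -m - 1) ∉ A)
    (h6 : ∃ w, Reach (A ∪ bx m)ᶜ (x6, -m - 1) w ∧ far M w)
    (hL : ∃ w, Reach (A ∪ bx m)ᶜ (-m - 1, yL) w ∧ far M w) :
    ¬ Reach A (m + 1, y1) (x5, -m - 1) := by
  set r : ℤ × ℤ → ℤ × ℤ := fun v => (v.1, -v.2) with hr
  have hrn : ∀ u v, nbr u v → nbr (r u) (r v) := by
    intro u v h; simp only [nbr, hr] at *; omega
  have hrr : ∀ v, r (r v) = v := by intro v; simp [hr]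
  have hfar : ∀ w, far M w → far M (r w) := by
    intro w h; simp only [far, hr] at *; omega
  have hbx : ∀ w, w ∈ bx m → r w ∈ bx m := by
    intro w h; simp only [bx, hr, Set.mem_ofPred_eq] at *; omega
  have e1 : ((x5, -m - 1) : ℤ × ℤ) = r (x5, m + 1) := by
    simp only [hr]; rw [neg_add']
  have e2 : ((x6, -m - 1) : ℤ × ℤ) = r (x6, m + 1) := by
    simp only [hr]; rw [neg_add']
  have e1' : r (x5, -m - 1) = (x5, m + 1) := by rw [e1, hrr]
  have e2' : r (x6, -m - 1) = (x6, m + 1) := by rw [e2, hrr]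
  have hcompl : ∀ v ∈ (A ∪ bx m)ᶜ, r v ∈ (r ⁻¹' A ∪ bx m)ᶜ := by
    rintro v hv (h | h)
    · rw [Set.mem_preimage, hrr] at h; exact hv (Or.inl h)
    · have := hbx _ h
      rw [hrr] at this; exact hv (Or.inr this)
  have key := sep_side (r ⁻¹' A) m M hm0 hm (by
      intro v hv
      have := hA _ hv
      exact ⟨fun h => this.1 (hbx _ h), fun h => this.2 (hfar _ h)⟩)
    (-y1) x5 x6 (-yL) (by omega) hx5 hx6 (by omega)
    (by rw [Set.mem_preimage]; simpa [hr] using hs) (by rw [Set.mem_preimage, ← e1]; exact ht)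
    (by rw [Set.mem_preimage, ← e2]; exact hu)
    (by
      obtain ⟨w, hw, hf⟩ := h6
      refine ⟨r w, ?_, hfar _ hf⟩
      have := hw.map r hrn hcompl
      rwa [e2'] at this)
    (by
      obtain ⟨w, hw, hf⟩ := hL
      exact ⟨r w, hw.map r hrn hcompl, hfar _ hf⟩)
  intro h
  apply key
  have := h.map (S' := r ⁻¹' A) r hrn (by intro u hu; rw [Set.mem_preimage, hrr]; exact hu)
  rwa [e1'] at this

end Perc

namespace Perc

/-! ### Part D: arms -/

/-- The sites of spin `b`. -/
def spin (σ : Cfg) (b : Bool) : Set (ℤ × ℤ) := {v | σ v = b}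

/-- The annulus between two boxes. -/
def ann (m N : ℤ) : Set (ℤ × ℤ) := {v | v ∉ bx m ∧ v ∈ bx N}

/-- There is an arm of sign `b` from the arc `D` to distance `N`. -/
def Arm (σ : Cfg) (b : Bool) (m N : ℤ) (D : Set (ℤ × ℤ)) : Prop :=
  ∃ s ∈ D, σ s = b ∧ ∃ w, Reach (spin σ b ∩ ann m N) s w ∧ far N w

lemma Arm.congr {σ τ : Cfg} {b : Bool} {m N : ℤ} {D : Set (ℤ × ℤ)} (hD : D ⊆ ann m N)
    (h : ∀ v ∈ ann m N, σ v = τ v) (hσ : Arm σ b m N D) : Arm τ b m N D := by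
  obtain ⟨s, hs, hb, w, hw, hf⟩ := hσ
  refine ⟨s, hs, by rw [← h s (hD hs), hb], w, hw.mono ?_, hf⟩
  rintro v ⟨h1, h2⟩
  refine ⟨?_, h2⟩
  simp only [spin, Set.mem_ofPred_eq] at *
  rw [← h v h2, h1]

/-- Box as a finset. -/
noncomputable def bxF (n : ℤ) : Finset (ℤ × ℤ) := Finset.Icc (-n) n ×ˢ Finset.Icc (-n) n

lemma mem_bxF {n : ℤ} {v : ℤ × ℤ} : v ∈ bxF n ↔ v ∈ bx n := by
  simp only [bxF, Finset.mem_product, Finset.mem_Icc, bx, Set.mem_ofPred_eq]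
  omega

/-- The dihedral symmetries, indexed by triples of booleans. -/
def sym (k : Bool × Bool × Bool) : (ℤ × ℤ) ≃ (ℤ × ℤ) :=
  (if k.1 then Equiv.prodComm ℤ ℤ else Equiv.refl _).trans
    (Equiv.prodCongr (if k.2.1 then Equiv.neg ℤ else Equiv.refl _)
      (if k.2.2 then Equiv.neg ℤ else Equiv.refl _))

lemma sym_apply (k : Bool × Bool × Bool) (v : ℤ × ℤ) :
    sym k v = ((if k.2.1 then -(if k.1 then v.2 else v.1) else (if k.1 then v.2 else v.1)),
      (if k.2.2 then -(if k.1 then v.1 else v.2) else (if k.1 then v.1 else v.2))) := by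
  obtain ⟨a, b, c⟩ := k
  cases a <;> cases b <;> cases c <;> rfl

lemma sym_nbr (k : Bool × Bool × Bool) (u v : ℤ × ℤ) : nbr (sym k u) (sym k v) ↔ nbr u v := by
  rw [sym_apply, sym_apply]
  obtain ⟨a, b, c⟩ := k
  cases a <;> cases b <;> cases c <;> simp only [nbr] <;> grind

lemma sym_bx (k : Bool × Bool × Bool) (m : ℤ) (v : ℤ × ℤ) : sym k v ∈ bx m ↔ v ∈ bx m := by
  rw [sym_apply]
  obtain ⟨a, b, c⟩ := k
  cases a <;> cases b <;> cases c <;> simp only [bx, Set.mem_ofPred_eq] <;> grind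

lemma sym_far (k : Bool × Bool × Bool) (m : ℤ) (v : ℤ × ℤ) : far m (sym k v) ↔ far m v := by
  rw [sym_apply]
  obtain ⟨a, b, c⟩ := k
  cases a <;> cases b <;> cases c <;> simp only [far] <;> grind

/-- The basic half side. -/
def arc0 (m : ℤ) : Set (ℤ × ℤ) := {v | v.1 = m + 1 ∧ 0 ≤ v.2 ∧ v.2 ≤ m}

/-- The eight half sides. -/
def arc (k : Bool × Bool × Bool) (m : ℤ) : Set (ℤ × ℤ) := {v | sym k v ∈ arc0 m}

lemma arc_sub (k : Bool × Bool × Bool) {m N : ℤ} (hN : m + 1 ≤ N) : arc k m ⊆ ann m N := by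
  intro v hv
  have hv' : sym k v ∈ arc0 m := hv
  refine ⟨?_, ?_⟩
  · rw [← sym_bx k]
    simp only [arc0, bx, Set.mem_ofPred_eq] at *; omega
  · rw [← sym_bx k]
    simp only [arc0, bx, Set.mem_ofPred_eq] at *; omega

/-- An exterior neighbour of the box lies in an arc. -/
lemma mem_arc_of_nbr {m : ℤ} {u v : ℤ × ℤ} (hu : u ∈ bx m) (hv : v ∉ bx m) (h : nbr u v) :
    ∃ k, v ∈ arc k m := by
  obtain ⟨x, y⟩ := u
  obtain ⟨x', y'⟩ := v
  simp only [bx, Set.mem_ofPred_eq] at hu hv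
  rcases nbr_cases h with ⟨rfl, rfl⟩ | ⟨rfl, rfl⟩ | ⟨rfl, rfl⟩ | ⟨rfl, rfl⟩
  · refine ⟨(false, false, decide (y' < 0)), ?_⟩
    simp only [arc, arc0, Set.mem_ofPred_eq, sym_apply]; grind
  · refine ⟨(false, true, decide (y' < 0)), ?_⟩
    simp only [arc, arc0, Set.mem_ofPred_eq, sym_apply]; grind
  · refine ⟨(true, false, decide (x' < 0)), ?_⟩
    simp only [arc, arc0, Set.mem_ofPred_eq, sym_apply]; grind
  · refine ⟨(true, true, decide (x' < 0)), ?_⟩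
    simp only [arc, arc0, Set.mem_ofPred_eq, sym_apply]; grind

/-- The event that there is no arm from the arc `k`. -/
def noArm (b : Bool) (m N : ℤ) (k : Bool × Bool × Bool) : Set Cfg := {σ | ¬ Arm σ b m N (arc k m)}

lemma noArm_dep (b : Bool) {m N : ℤ} (hN : m + 1 ≤ N) (k : Bool × Bool × Bool) :
    DependsOnFin (bxF N) (noArm b m N k) := by
  intro σ τ h hσ hτ
  exact hσ (hτ.congr (arc_sub k hN) (fun v hv => (h v (mem_bxF.2 hv.2)).symm))

lemma noArm_decr (m N : ℤ) (k : Bool × Bool × Bool) : Decr (noArm true m N k) := by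
  rintro σ τ h hσ ⟨s, hs, hb, w, hw, hf⟩
  exact hσ ⟨s, hs, h s hb, w, hw.mono (fun v hv => ⟨h v hv.1, hv.2⟩), hf⟩

lemma noArm_neg (μ : Measure Cfg) [IsProbabilityMeasure μ] (hμ : Fair μ) {m N : ℤ}
    (hN : m + 1 ≤ N) (k : Bool × Bool × Bool) :
    μ (noArm false m N k) = μ (noArm true m N k) := by
  rw [← (map_neg μ hμ).measure_preimage (noArm_dep false hN k).measurableSet.nullMeasurableSet]
  congr 1
  ext σ
  simp only [noArm, Set.mem_preimage, Set.mem_ofPred_eq, Arm, spin, Bool.not_eq_false']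

lemma noArm_sym (μ : Measure Cfg) [IsProbabilityMeasure μ] (hμ : Fair μ) {m N : ℤ}
    (hN : m + 1 ≤ N) (k : Bool × Bool × Bool) :
    μ (noArm true m N k) = μ (noArm true m N (false, false, false)) := by
  rw [← (map_sites μ hμ (sym k)).measure_preimage (noArm_dep true hN k).measurableSet.nullMeasurableSet]
  congr 1
  ext σ
  simp only [noArm, Set.mem_preimage, Set.mem_ofPred_eq]
  rw [not_iff_not]
  have e0 : ∀ v, v ∈ arc (false, false, false) m ↔ v ∈ arc0 m := by
    intro v; simp [arc, sym_apply]
  constructor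
  · rintro ⟨s, hs, hb, w, hw, hf⟩
    refine ⟨sym k s, (e0 _).2 hs, hb, sym k w, ?_, (sym_far k N w).2 hf⟩
    refine hw.map (sym k) (fun u v h => (sym_nbr k u v).2 h) ?_
    rintro u ⟨h1, h2, h3⟩
    exact ⟨h1, fun h => h2 ((sym_bx k m u).1 h), (sym_bx k N u).2 h3⟩
  · rintro ⟨s, hs, hb, w, hw, hf⟩
    refine ⟨(sym k).symm s, ?_, ?_, (sym k).symm w, ?_, ?_⟩
    · simpa [arc] using (e0 _).1 hs
    · simpa using hb
    · refine hw.map (sym k).symm (fun u v h => ?_) ?_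
      · rw [← sym_nbr k]; simpa using h
      · rintro u ⟨h1, h2, h3⟩
        refine ⟨?_, fun h => h2 ?_, ?_⟩
        · simpa [spin] using h1
        · rw [← sym_bx k] at h; simpa using h
        · rw [← sym_bx k]; simpa using h3
    · rw [← sym_far k]; simpa using hf

lemma harris_arms (μ : Measure Cfg) [IsProbabilityMeasure μ] (hμ : Fair μ) {m N : ℤ}
    (hN : m + 1 ≤ N) (K : Finset (Bool × Bool × Bool)) :
    (μ (noArm true m N (false, false, false))) ^ K.card ≤ μ (⋂ k ∈ K, noArm true m N k) ∧
    DependsOnFin (bxF N) (⋂ k ∈ K, noArm true m N k) ∧ Decr (⋂ k ∈ K, noArm true m N k) := by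
  induction K using Finset.induction_on with
  | empty =>
    refine ⟨by simp, ?_, ?_⟩
    · intro σ τ _ _; simp
    · intro σ τ _ _; simp
  | insert k K hk ih =>
    obtain ⟨h1, h2, h3⟩ := ih
    have e : (⋂ j ∈ insert k K, noArm true m N j) = noArm true m N k ∩ ⋂ j ∈ K, noArm true m N j := by
      ext σ; simp
    rw [e]
    refine ⟨?_, ?_, ?_⟩
    · rw [Finset.card_insert_of_notMem hk, pow_succ']
      refine le_trans ?_ (harris μ hμ (noArm_dep true hN k) h2 (noArm_decr m N k) h3)
      rw [noArm_sym μ hμ hN k]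
      gcongr
    · intro σ τ h hs
      exact ⟨noArm_dep true hN k σ τ h hs.1, h2 σ τ h hs.2⟩
    · intro σ τ h hs
      exact ⟨noArm_decr m N k σ τ h hs.1, h3 σ τ h hs.2⟩

/-- Some site of the box has an infinite `true` cluster. -/
def infBox (m : ℤ) : Set Cfg := {σ | ∃ x ∈ bx m, {y | Reach (spin σ true) x y}.Infinite}

lemma bx_finite (n : ℤ) : (bx n).Finite :=
  (bxF n).finite_toSet.subset (fun _ hv => mem_bxF.2 hv)

lemma infBox_arm {m N : ℤ} (hN : m + 1 ≤ N) {σ : Cfg} (hσ : σ ∈ infBox m) :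
    ∃ k, Arm σ true m N (arc k m) := by
  obtain ⟨x, hx, hinf⟩ := hσ
  by_contra hcon
  push Not at hcon
  apply hinf
  refine (bx_finite N).subset fun y hy => ?_
  have key := Reach.inv hy (fun v => v ∈ bx m ∨ (v ∈ ann m N ∧ ∃ k, ∃ s ∈ arc k m, σ s = true ∧
    Reach (spin σ true ∩ ann m N) s v)) (Or.inl hx) (by
      intro u v hP hn hu hv
      by_cases hvm : v ∈ bx m
      · exact Or.inl hvm
      right
      rcases hP with hP | ⟨hP, k, s, hs, hb, hr⟩
      · obtain ⟨k, hk⟩ := mem_arc_of_nbr hP hvm hn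
        exact ⟨arc_sub k hN hk, k, v, hk, hv, Reach.refl⟩
      · have hnf : ¬ far N u := fun hf => hcon k ⟨s, hs, hb, u, hr, hf⟩
        have hva : v ∈ ann m N := by
          refine ⟨hvm, ?_⟩
          simp only [far, bx, nbr, Set.mem_ofPred_eq] at *
          omega
        exact ⟨hva, k, s, hs, hb, hr.trans (Reach.step hn ⟨hu, hP⟩ ⟨hv, hva⟩)⟩)
  rcases key with h | h
  · simp only [bx, Set.mem_ofPred_eq] at *; omega
  · exact h.1.2

lemma arm_prob (μ : Measure Cfg) [IsProbabilityMeasure μ] (hμ : Fair μ) {m : ℤ}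
    (hm : 1 < μ (infBox m) + (1 / 16 : ENNReal) ^ 8) {N : ℤ}
    (hN : m + 1 ≤ N) (b : Bool) (k : Bool × Bool × Bool) : μ (noArm b m N k) ≤ 1 / 16 := by
  have h1 : μ (noArm b m N k) = μ (noArm true m N (false, false, false)) := by
    cases b
    · rw [noArm_neg μ hμ hN, noArm_sym μ hμ hN]
    · rw [noArm_sym μ hμ hN]
  rw [h1]
  obtain ⟨h2, h3, -⟩ := harris_arms μ hμ hN (Finset.univ : Finset (Bool × Bool × Bool))
  set X := ⋂ k ∈ (Finset.univ : Finset (Bool × Bool × Bool)), noArm true m N k with hX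
  have hsub : infBox m ⊆ Xᶜ := by
    intro σ hσ hc
    obtain ⟨k, hk⟩ := infBox_arm hN hσ
    simp only [hX, Set.mem_iInter] at hc
    exact hc k (Finset.mem_univ _) hk
  have h4 : μ (infBox m) + μ X ≤ 1 := by
    rw [← prob_add_prob_compl (μ := μ) h3.measurableSet, add_comm]
    gcongr
  by_contra hcon
  push Not at hcon
  have h5 : (1 / 16 : ENNReal) ^ 8 < μ (noArm true m N (false, false, false)) ^ 8 :=
    ENNReal.pow_lt_pow_left (by norm_num) hcon
  have h6 : (Finset.univ : Finset (Bool × Bool × Bool)).card = 8 := by decide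
  rw [h6] at h2
  have h7 : μ (infBox m) + (1 / 16 : ENNReal) ^ 8 ≤ 1 :=
    le_trans (by gcongr; exact h5.le.trans h2) h4
  exact absurd hm (not_lt.2 h7)

end Perc

namespace Perc

/-! ### Part E: trifurcation boxes -/

/-- The six arms which are used. -/
def six : Finset (Bool × (Bool × Bool × Bool)) :=
  {(true, (false, false, false)), (false, (true, false, false)), (true, (true, false, true)),
    (false, (false, true, false)), (true, (true, true, true)), (false, (true, true, false))}

/-- The six arm event. -/
def sixArms (m N : ℤ) : Set Cfg := {σ | ∀ p ∈ six, Arm σ p.1 m N (arc p.2 m)}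

/-- The trifurcation event. -/
def trif (m N : ℤ) : Set Cfg := sixArms m N ∩ cyl (bxF m) (fun _ => true)

lemma sixArms_prob (μ : Measure Cfg) [IsProbabilityMeasure μ] (hμ : Fair μ) {m : ℤ}
    (hm : 1 < μ (infBox m) + (1 / 16 : ENNReal) ^ 8) {N : ℤ} (hN : m + 1 ≤ N) :
    1 / 2 ≤ μ (sixArms m N) := by
  have h1 : (sixArms m N)ᶜ ⊆ ⋃ p ∈ six, noArm p.1 m N p.2 := by
    intro σ hσ
    simp only [sixArms, Set.mem_compl_iff, Set.mem_ofPred_eq] at hσ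
    push Not at hσ
    obtain ⟨p, hp, hp'⟩ := hσ
    simp only [Set.mem_iUnion]
    exact ⟨p, hp, hp'⟩
  have h2 : μ (⋃ p ∈ six, noArm p.1 m N p.2) ≤ 6 / 16 := by
    refine (measure_biUnion_finset_le _ _).trans ?_
    refine (Finset.sum_le_card_nsmul six _ (1 / 16) (fun p _ => arm_prob μ hμ hm hN p.1 p.2)).trans ?_
    have : six.card = 6 := by decide
    rw [this, nsmul_eq_mul, ← mul_div_assoc, mul_one]
    norm_num
  have h3 : (1 : ENNReal) ≤ μ (sixArms m N) + 6 / 16 := by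
    calc (1 : ENNReal) = μ (sixArms m N ∪ (sixArms m N)ᶜ) := by simp
      _ ≤ μ (sixArms m N) + μ ((sixArms m N)ᶜ) := measure_union_le _ _
      _ ≤ _ := by gcongr; exact (measure_mono h1).trans h2
  by_contra hcon
  push Not at hcon
  have h4 : μ (sixArms m N) + 6 / 16 < 1 / 2 + 6 / 16 := by
    refine ENNReal.add_lt_add_right ?_ hcon
    exact ENNReal.div_ne_top (by norm_num) (by norm_num)
  have h5 : (1 / 2 + 6 / 16 : ENNReal) ≤ 1 := by
    have : (1 / 2 + 6 / 16 : ENNReal) = ENNReal.ofReal (1 / 2 + 6 / 16) := by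
      rw [ENNReal.ofReal_add (by norm_num) (by norm_num), ENNReal.ofReal_div_of_pos (by norm_num),
        ENNReal.ofReal_div_of_pos (by norm_num)]
      norm_num
    rw [this]
    norm_num
  exact absurd (h3.trans_lt h4) (not_lt.2 h5)

lemma sixArms_dep {m N : ℤ} (hN : m + 1 ≤ N) : DependsOnFin (bxF N) (sixArms m N) := by
  intro σ τ h hσ p hp
  exact (hσ p hp).congr (arc_sub _ hN) (fun v hv => h v (mem_bxF.2 hv.2))

lemma trif_dep {m N : ℤ} (hN : m + 1 ≤ N) : DependsOnFin (bxF N) (trif m N) := by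
  intro σ τ h hσ
  refine ⟨sixArms_dep hN σ τ h hσ.1, fun x hx => ?_⟩
  rw [← h x, hσ.2 x hx]
  rw [mem_bxF] at *
  simp only [bx, Set.mem_ofPred_eq] at *; omega

lemma trif_prob (μ : Measure Cfg) [IsProbabilityMeasure μ] (hμ : Fair μ) {m : ℤ}
    (hm : 1 < μ (infBox m) + (1 / 16 : ENNReal) ^ 8) {N : ℤ} (hN : m + 1 ≤ N) :
    1 / 2 * (1 / 2 : ENNReal) ^ (bxF m).card ≤ μ (trif m N) := by
  rw [trif, indep_cyl μ hμ (sixArms m N) (bxF m)]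
  · gcongr
    exact sixArms_prob μ hμ hm hN
  · intro x hx σ hσ p hp
    refine (hσ p hp).congr (arc_sub _ hN) (fun v hv => ?_)
    have : v ≠ x := by
      rintro rfl
      exact hv.1 (mem_bxF.1 hx)
    simp [flipAt, this]

/-- A plus arm leads to the boundary of a finite region. -/
lemma arm_to_boundary {σ : Cfg} {m N : ℤ} {Q : Set (ℤ × ℤ)} (hQN : ∀ v ∈ Q, ¬ far N v)
    {s w : ℤ × ℤ} (hsG : s ∈ (spin σ true ∩ Q) \ bx m)
    (hw : Reach (spin σ true ∩ ann m N) s w) (hf : far N w) :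
    ∃ y, Reach ((spin σ true ∩ Q) \ bx m) s y ∧ y ∈ Q ∧ ∃ z, z ∉ Q ∧ nbr y z := by
  have key := hw.inv (fun v => Reach ((spin σ true ∩ Q) \ bx m) s v ∨
    ∃ y, Reach ((spin σ true ∩ Q) \ bx m) s y ∧ y ∈ Q ∧ ∃ z, z ∉ Q ∧ nbr y z) (Or.inl Reach.refl) (by
      intro u v hP hn hu hv
      rcases hP with hP | hP
      swap
      · exact Or.inr hP
      have hu' := hP.mem hsG
      by_cases hvQ : v ∈ Q
      · left
        exact hP.trans (Reach.step hn hu' ⟨⟨hv.1, hvQ⟩, hv.2.1⟩)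
      · right
        exact ⟨u, hP, hu'.1.2, v, hvQ, hn⟩)
  rcases key with h | h
  · exact absurd hf (hQN w (h.mem hsG).1.2)
  · exact h

lemma trif_det {σ : Cfg} {m N : ℤ} (hm : 0 ≤ m) (hN : m + 1 ≤ N) (hσ : σ ∈ trif m N)
    (Q : Set (ℤ × ℤ)) (hQN : ∀ v ∈ Q, ¬ far N v) (hQ : bx (m + 1) ⊆ Q) :
    ∃ a : Fin 3 → ℤ × ℤ, (∀ i, a i ∈ (spin σ true ∩ Q) \ bx m) ∧
      (∀ i, ∃ s ∈ bx m, nbr s (a i)) ∧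
      (∀ i j, i ≠ j → ¬ Reach ((spin σ true ∩ Q) \ bx m) (a i) (a j)) ∧
      ∀ i, ∃ y, Reach ((spin σ true ∩ Q) \ bx m) (a i) y ∧ y ∈ Q ∧ ∃ z, z ∉ Q ∧ nbr y z := by
  have h6 := hσ.1
  obtain ⟨⟨r1, r2⟩, hr, hrb, wr, hwr, hfr⟩ := h6 (true, (false, false, false)) (by decide)
  obtain ⟨⟨t1, t2⟩, ht, htb, wt, hwt, hft⟩ := h6 (true, (true, false, true)) (by decide)
  obtain ⟨⟨b1, b2⟩, hb, hbb, wb, hwb, hfb⟩ := h6 (true, (true, true, true)) (by decide)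
  obtain ⟨⟨p1, p2⟩, hp, hpb, wp, hwp, hfp⟩ := h6 (false, (true, false, false)) (by decide)
  obtain ⟨⟨q1, q2⟩, hq, hqb, wq, hwq, hfq⟩ := h6 (false, (false, true, false)) (by decide)
  obtain ⟨⟨l1, l2⟩, hl, hlb, wl, hwl, hfl⟩ := h6 (false, (true, true, false)) (by decide)
  simp only [arc, arc0, Set.mem_ofPred_eq, sym_apply] at hr ht hb hp hq hl
  simp only [if_true, Bool.false_eq_true, if_false] at hr ht hb hp hq hl
  simp only at hrb htb hbb hpb hqb hlb hwr hwt hwb hwp hwq hwl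
  obtain rfl : r1 = m + 1 := by omega
  obtain rfl : t2 = m + 1 := by omega
  obtain rfl : b2 = -m - 1 := by omega
  obtain rfl : p2 = m + 1 := by omega
  obtain rfl : q1 = -m - 1 := by omega
  obtain rfl : l2 = -m - 1 := by omega
  set A := (spin σ true ∩ Q) \ bx m with hA
  have hAA : ∀ v ∈ A, v ∉ bx m ∧ ¬ far N v := fun v hv => ⟨hv.2, hQN v hv.1.2⟩
  have memA : ∀ x y, σ (x, y) = true → (x, y) ∈ bx (m + 1) → (x, y) ∉ bx m → (x, y) ∈ A :=
    fun x y h1 h2 h3 => ⟨⟨h1, hQ h2⟩, h3⟩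
  have notA : ∀ v, σ v = false → v ∉ A := by
    intro v h1 h2
    have : σ v = true := h2.1.1
    rw [h1] at this
    exact absurd this (by decide)
  have minus : ∀ u w, Reach (spin σ false ∩ ann m N) u w → Reach (A ∪ bx m)ᶜ u w := by
    intro u w h
    refine h.mono ?_
    rintro v ⟨h1, h2⟩ (h3 | h3)
    · exact notA v h1 h3
    · exact h2.1 h3
  have hrA : (m + 1, r2) ∈ A := memA _ _ hrb (by simp only [bx, Set.mem_ofPred_eq]; omega)
    (by simp only [bx, Set.mem_ofPred_eq]; omega)
  have htA : (t1, m + 1) ∈ A := memA _ _ htb (by simp only [bx, Set.mem_ofPred_eq]; omega)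
    (by simp only [bx, Set.mem_ofPred_eq]; omega)
  have hbA : (b1, -m - 1) ∈ A := memA _ _ hbb (by simp only [bx, Set.mem_ofPred_eq]; omega)
    (by simp only [bx, Set.mem_ofPred_eq]; omega)
  have s1 : ¬ Reach A (m + 1, r2) (t1, m + 1) :=
    sep_side A m N hm (by omega) hAA r2 t1 p1 q2 (by omega) (by omega) (by omega) (by omega)
      hrA htA (notA _ hpb) ⟨wp, minus _ _ hwp, hfp⟩ ⟨wq, minus _ _ hwq, hfq⟩
  have s2 : ¬ Reach A (t1, m + 1) (b1, -m - 1) :=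
    sep_vert A m N hm (by omega) hAA t1 p1 b1 q2 (by omega) (by omega) (by omega) (by omega)
      htA hbA (notA _ hpb) ⟨wp, minus _ _ hwp, hfp⟩ ⟨wq, minus _ _ hwq, hfq⟩
  have s3 : ¬ Reach A (m + 1, r2) (b1, -m - 1) :=
    sep_side' A m N hm (by omega) hAA r2 b1 l1 q2 (by omega) (by omega) (by omega) (by omega)
      hrA hbA (notA _ hlb) ⟨wl, minus _ _ hwl, hfl⟩ ⟨wq, minus _ _ hwq, hfq⟩
  refine ⟨![(m + 1, r2), (t1, m + 1), (b1, -m - 1)], ?_, ?_, ?_, ?_⟩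
  · intro i
    fin_cases i
    · exact hrA
    · exact htA
    · exact hbA
  · intro i
    fin_cases i
    · refine ⟨(m, r2), ?_, ?_⟩
      · simp only [bx, Set.mem_ofPred_eq]; omega
      · simp [nbr]
    · refine ⟨(t1, m), ?_, ?_⟩
      · simp only [bx, Set.mem_ofPred_eq]; omega
      · simp [nbr]
    · refine ⟨(b1, -m), ?_, ?_⟩
      · simp only [bx, Set.mem_ofPred_eq]; omega
      · simp [nbr]
  · intro i j hij
    fin_cases i <;> fin_cases j
    · exact absurd rfl hij
    · exact s1
    · exact s3
    · exact fun h => s1 h.symm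
    · exact absurd rfl hij
    · exact s2
    · exact fun h => s3 h.symm
    · exact fun h => s2 h.symm
    · exact absurd rfl hij
  · intro i
    fin_cases i
    · exact arm_to_boundary hQN hrA hwr hfr
    · exact arm_to_boundary hQN htA hwt hft
    · exact arm_to_boundary hQN hbA hwb hfb

end Perc

namespace Perc

/-! ### Part F: conclusion -/

lemma bx_conn_zero (m : ℤ) (n : ℕ) : ∀ x y : ℤ, (x, y) ∈ bx m → x.natAbs + y.natAbs = n →
    Reach (bx m) (x, y) (0, 0) := by
  induction n with
  | zero =>
    intro x y _ h
    obtain rfl : x = 0 := by omega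
    obtain rfl : y = 0 := by omega
    exact Reach.refl
  | succ n ih =>
    intro x y hv h
    have go : ∀ x' y' : ℤ, (x', y') ∈ bx m → nbr (x, y) (x', y') → x'.natAbs + y'.natAbs = n →
        Reach (bx m) (x, y) (0, 0) :=
      fun x' y' h1 h2 h3 => (Reach.step h2 hv h1).trans (ih x' y' h1 h3)
    simp only [bx, nbr, Set.mem_ofPred_eq] at hv go
    rcases lt_trichotomy x 0 with hx | hx | hx
    · exact go (x + 1) y (by omega) (by omega) (by omega)
    · rcases lt_trichotomy y 0 with hy | hy | hy
      · exact go x (y + 1) (by omega) (by omega) (by omega)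
      · omega
      · exact go x (y - 1) (by omega) (by omega) (by omega)
    · exact go (x - 1) y (by omega) (by omega) (by omega)

lemma bx_conn (m : ℤ) (u v : ℤ × ℤ) (hu : u ∈ bx m) (hv : v ∈ bx m) : Reach (bx m) u v :=
  (bx_conn_zero m _ u.1 u.2 hu rfl).trans (bx_conn_zero m _ v.1 v.2 hv rfl).symm

/-- Translated configuration. -/
def shift (c : ℤ × ℤ) (σ : Cfg) : Cfg := fun v => σ (Equiv.addRight c v)

lemma nbr_add {u v c : ℤ × ℤ} (h : nbr u v) : nbr (u + c) (v + c) := by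
  simp only [nbr, Prod.fst_add, Prod.snd_add] at *; omega

lemma nbr_sub {u v c : ℤ × ℤ} (h : nbr u v) : nbr (u - c) (v - c) := by
  simp only [nbr, Prod.fst_sub, Prod.snd_sub] at *; omega

/-- Inner boundary of the box. -/
noncomputable def bdry (K : ℤ) : Finset (ℤ × ℤ) :=
  ((({K, -K} : Finset ℤ) ×ˢ Finset.Icc (-K) K) ∪ (Finset.Icc (-K) K ×ˢ ({K, -K} : Finset ℤ)))

lemma bdry_card (K : ℤ) : (bdry K).card ≤ 4 * (2 * K + 1).toNat := by
  refine (Finset.card_union_le _ _).trans ?_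
  rw [Finset.card_product, Finset.card_product, Int.card_Icc]
  have h : ({K, -K} : Finset ℤ).card ≤ 2 := Finset.card_le_two
  have e : (K + 1 - -K).toNat = (2 * K + 1).toNat := by congr 1; ring
  rw [e]
  nlinarith

lemma mem_bdry {K : ℤ} {y z : ℤ × ℤ} (hy : y ∈ bx K) (hz : z ∉ bx K) (h : nbr y z) :
    y ∈ bdry K := by
  simp only [bdry, Finset.mem_union, Finset.mem_product, Finset.mem_insert, Finset.mem_singleton,
    Finset.mem_Icc]
  simp only [bx, nbr, Set.mem_ofPred_eq] at hy hz h
  omega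

/-- Centers. -/
def ctr (m : ℤ) (p : ℤ × ℤ) : ℤ × ℤ := ((2 * m + 1) * p.1, (2 * m + 1) * p.2)

open Classical in
lemma count_trif (σ : Cfg) {m k K N : ℤ} (hm : 0 ≤ m) (hk : 0 ≤ k)
    (hK : K = (2 * m + 1) * k + m + 1) (hN : N = 2 * K + 1) :
    ((bxF k).filter (fun p => shift (ctr m p) σ ∈ trif m N)).card ≤ (bdry K).card := by
  set T := (bxF k).filter (fun p => shift (ctr m p) σ ∈ trif m N) with hT
  have hctr : ∀ p ∈ T, -(K - m - 1) ≤ (ctr m p).1 ∧ (ctr m p).1 ≤ K - m - 1 ∧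
      -(K - m - 1) ≤ (ctr m p).2 ∧ (ctr m p).2 ≤ K - m - 1 := by
    intro p hp
    have := mem_bxF.1 (Finset.mem_filter.1 hp).1
    simp only [bx, Set.mem_ofPred_eq] at this
    simp only [ctr]
    refine ⟨?_, ?_, ?_, ?_⟩ <;> nlinarith
  have hKpos : m + 1 ≤ K := by nlinarith
  have det : ∀ p : ℤ × ℤ, ∃ a : Fin 3 → ℤ × ℤ, p ∈ T →
      (∀ i, a i ∈ (spin (shift (ctr m p) σ) true ∩ {v | v + ctr m p ∈ bx K}) \ bx m) ∧
      (∀ i, ∃ s ∈ bx m, nbr s (a i)) ∧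
      (∀ i j, i ≠ j → ¬ Reach ((spin (shift (ctr m p) σ) true ∩ {v | v + ctr m p ∈ bx K}) \ bx m)
        (a i) (a j)) ∧
      ∀ i, ∃ y, Reach ((spin (shift (ctr m p) σ) true ∩ {v | v + ctr m p ∈ bx K}) \ bx m) (a i) y ∧
        y ∈ {v | v + ctr m p ∈ bx K} ∧ ∃ z, z ∉ {v | v + ctr m p ∈ bx K} ∧ nbr y z := by
    intro p
    by_cases hp : p ∈ T
    swap
    · exact ⟨fun _ => 0, fun h => absurd h hp⟩
    have h0 := hctr p hp
    obtain ⟨a, ha⟩ := trif_det hm (by omega : m + 1 ≤ N) (Finset.mem_filter.1 hp).2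
      {v | v + ctr m p ∈ bx K} (by
        intro v hv
        simp only [bx, Set.mem_ofPred_eq, Prod.fst_add, Prod.snd_add] at hv
        simp only [far]
        omega) (by
        intro v hv
        simp only [bx, Set.mem_ofPred_eq, Prod.fst_add, Prod.snd_add] at *
        omega)
    exact ⟨a, fun _ => ha⟩
  choose a ha using det
  have hiff : ∀ p v, v ∈ (spin (shift (ctr m p) σ) true ∩ {v | v + ctr m p ∈ bx K}) \ bx m ↔
      v + ctr m p ∈ (spin σ true ∩ bx K) \ {v | v - ctr m p ∈ bx m} := by
    intro p v
    simp [spin, shift, Set.mem_sdiff]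
  have trf : ∀ p u w, Reach ((spin (shift (ctr m p) σ) true ∩ {v | v + ctr m p ∈ bx K}) \ bx m) u w →
      Reach ((spin σ true ∩ bx K) \ {v | v - ctr m p ∈ bx m}) (u + ctr m p) (w + ctr m p) := by
    intro p u w h
    exact h.map (fun v => v + ctr m p) (fun _ _ h => nbr_add h) (fun v hv => (hiff p v).1 hv)
  refine counting (spin σ true ∩ bx K) ((bx_finite K).subset Set.inter_subset_right)
    (fun p => {v | v - ctr m p ∈ bx m}) (fun p i => a p i + ctr m p) _ T (bdry K) rfl
    ?_ ?_ ?_ ?_ ?_ ?_ ?_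
  · intro p hp v hv
    have h0 := hctr p hp
    have h1 := (Finset.mem_filter.1 hp).2.2 _ (mem_bxF.2 hv)
    refine ⟨?_, ?_⟩
    · simpa [shift, spin] using h1
    · simp only [bx, Set.mem_ofPred_eq, Prod.fst_sub, Prod.snd_sub] at *
      omega
  · intro p hp u hu v hv
    have := (bx_conn m _ _ hu hv).map (S' := {v | v - ctr m p ∈ bx m}) (fun v => v + ctr m p)
      (fun _ _ h => nbr_add h) (fun v hv => by simpa using hv)
    simpa using this
  · intro p hp q hq hne
    rw [Set.disjoint_left]
    intro v h1 h2
    apply hne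
    simp only [bx, Set.mem_ofPred_eq, Prod.fst_sub, Prod.snd_sub, ctr] at h1 h2
    have aux : ∀ i j : ℤ, (2 * m + 1) * i - (2 * m + 1) * j ≤ 2 * m → i ≤ j := by
      intro i j h
      by_contra hc
      push Not at hc
      nlinarith
    ext
    · exact le_antisymm (aux _ _ (by omega)) (aux _ _ (by omega))
    · exact le_antisymm (aux _ _ (by omega)) (aux _ _ (by omega))
  · intro p hp i
    exact (hiff p _).1 ((ha p hp).1 i)
  · intro p hp i
    obtain ⟨s, hs, hn⟩ := (ha p hp).2.1 i
    exact ⟨s + ctr m p, by simpa using hs, nbr_add hn⟩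
  · intro p hp i j hij h
    apply (ha p hp).2.2.1 i j hij
    have := h.map (S' := (spin (shift (ctr m p) σ) true ∩ {v | v + ctr m p ∈ bx K}) \ bx m)
      (fun v => v - ctr m p) (fun _ _ h => nbr_sub h)
      (fun v hv => by rw [hiff]; simpa using hv)
    simpa using this
  · intro p hp i
    obtain ⟨y, hy, hyQ, z, hz, hn⟩ := (ha p hp).2.2.2 i
    exact ⟨y + ctr m p, mem_bdry hyQ hz (nbr_add hn), trf p _ _ hy⟩

/-- There is an infinite `true` cluster. -/
def inf : Set Cfg := {σ | ∃ x, {y | Reach (spin σ true) x y}.Infinite}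

lemma nbr_finite (z : ℤ × ℤ) : {y | nbr z y}.Finite := by
  refine ((bx_finite 1).image (fun v => v + z)).subset fun y hy => ⟨y - z, ?_, by simp⟩
  simp only [nbr, bx, Set.mem_ofPred_eq, Prod.fst_sub, Prod.snd_sub] at *
  omega

lemma inf_flip (z : ℤ × ℤ) (σ : Cfg) (h : σ ∈ inf) : flipAt z σ ∈ inf := by
  obtain ⟨x, hx⟩ := h
  by_contra hcon
  simp only [inf, Set.mem_ofPred_eq, not_exists, Set.not_infinite] at hcon
  apply hx
  have hfin : (insert z (⋃ y ∈ insert x {y | nbr z y},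
      {v | Reach (spin (flipAt z σ) true) y v})).Finite :=
    (Set.Finite.biUnion ((nbr_finite z).insert x) (fun y _ => hcon y)).insert z
  refine hfin.subset fun v hv => ?_
  refine Reach.inv hv (fun v => v ∈ insert z (⋃ y ∈ insert x {y | nbr z y},
      {v | Reach (spin (flipAt z σ) true) y v})) ?_ ?_
  · right
    simp only [Set.mem_iUnion]
    exact ⟨x, Set.mem_insert _ _, Reach.refl⟩
  · intro u v hP hn hu hv
    by_cases hvz : v = z
    · left; exact hvz
    right
    simp only [Set.mem_iUnion]
    have hv' : v ∈ spin (flipAt z σ) true := by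
      simpa [spin, flipAt, hvz] using hv
    by_cases huz : u = z
    · subst huz
      exact ⟨v, Set.mem_insert_of_mem _ hn, Reach.refl⟩
    have hu' : u ∈ spin (flipAt z σ) true := by
      simpa [spin, flipAt, huz] using hu
    rcases hP with hP | hP
    · exact absurd hP huz
    · simp only [Set.mem_iUnion] at hP
      obtain ⟨y, hy, hr⟩ := hP
      exact ⟨y, hy, Reach.trans hr (Reach.step hn hu' hv')⟩

lemma exists_box (μ : Measure Cfg) [IsProbabilityMeasure μ] (h : μ inf = 1) :
    ∃ m : ℕ, 1 < μ (infBox m) + (1 / 16 : ENNReal) ^ 8 := by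
  have e : inf = ⋃ m : ℕ, infBox m := by
    ext σ
    simp only [inf, infBox, Set.mem_iUnion, Set.mem_ofPred_eq]
    constructor
    · rintro ⟨x, hx⟩
      refine ⟨x.1.natAbs + x.2.natAbs, x, ?_, hx⟩
      simp only [bx, Set.mem_ofPred_eq]; omega
    · rintro ⟨m, x, -, hx⟩
      exact ⟨x, hx⟩
  have mono : Monotone (fun m : ℕ => infBox m) := by
    rintro m n hmn σ ⟨x, hx, hi⟩
    refine ⟨x, ?_, hi⟩
    simp only [bx, Set.mem_ofPred_eq] at *; omega
  have ht := tendsto_measure_iUnion_atTop (μ := μ) mono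
  rw [← e, h] at ht
  have ht2 := ht.add_const ((1 / 16 : ENNReal) ^ 8)
  have hlt : (1 : ENNReal) < 1 + (1 / 16 : ENNReal) ^ 8 := by
    refine ENNReal.lt_add_right (by norm_num) ?_
    simp
  exact (ht2.eventually_const_lt hlt).exists

lemma inf_null (μ : Measure Cfg) [IsProbabilityMeasure μ] (hμ : Fair μ) : μ inf = 0 := by
  classical
  rcases zero_one μ hμ inf inf_flip with h | h
  · exact h
  exfalso
  obtain ⟨m, hm⟩ := exists_box μ h
  set κ : ENNReal := 1 / 2 * (1 / 2 : ENNReal) ^ (bxF m).card with hκ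
  have hκ0 : κ ≠ 0 := by simp [hκ]
  -- the key inequality
  have main : ∀ k : ℕ, ((2 * k + 1 : ℕ) : ENNReal) * κ ≤ ((4 * (2 * m + 3) : ℕ) : ENNReal) := by
    intro k
    set K : ℤ := (2 * m + 1) * k + m + 1 with hK
    set N : ℤ := 2 * K + 1 with hN
    have hKpos : (m : ℤ) + 1 ≤ K := by
      have : (0 : ℤ) ≤ (2 * m + 1) * k := by positivity
      omega
    have hmN : (m : ℤ) + 1 ≤ N := by omega
    have hmeas : ∀ p, MeasurableSet {σ | shift (ctr m p) σ ∈ trif m N} := fun p =>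
      (map_sites μ hμ (Equiv.addRight (ctr m p))).measurable (trif_dep hmN).measurableSet
    have hp : ∀ p, κ ≤ μ {σ | shift (ctr m p) σ ∈ trif m N} := by
      intro p
      have := (map_sites μ hμ (Equiv.addRight (ctr m p))).measure_preimage
        (trif_dep hmN).measurableSet.nullMeasurableSet
      calc κ ≤ μ (trif m N) := trif_prob μ hμ hm hmN
        _ = _ := this.symm
    have hsum : ∑ p ∈ bxF (k : ℤ), μ {σ | shift (ctr m p) σ ∈ trif m N} ≤ ((bdry K).card : ENNReal) := by
      calc ∑ p ∈ bxF (k : ℤ), μ {σ | shift (ctr m p) σ ∈ trif m N}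
          = ∑ p ∈ bxF (k : ℤ), ∫⁻ σ, ({σ | shift (ctr m p) σ ∈ trif m N}.indicator 1 σ) ∂μ := by
            refine Finset.sum_congr rfl fun p _ => ?_
            rw [lintegral_indicator_one (hmeas p)]
        _ = ∫⁻ σ, ∑ p ∈ bxF (k : ℤ), ({σ | shift (ctr m p) σ ∈ trif m N}.indicator 1 σ) ∂μ := by
            rw [lintegral_finsetSum]
            intro p _
            exact measurable_one.indicator (hmeas p)
        _ ≤ ∫⁻ σ, ((bdry K).card : ENNReal) ∂μ := by
            refine lintegral_mono fun σ => ?_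
            have := count_trif σ (m := m) (k := k) (K := K) (N := N) (by omega) (by omega) hK hN
            simp only [Set.indicator_apply, Set.mem_ofPred_eq, Pi.one_apply]
            rw [Finset.sum_boole]
            exact_mod_cast this
        _ = _ := by simp
    have hlow : ((bxF (k : ℤ)).card : ENNReal) * κ
        ≤ ∑ p ∈ bxF (k : ℤ), μ {σ | shift (ctr m p) σ ∈ trif m N} := by
      rw [← nsmul_eq_mul]
      exact Finset.card_nsmul_le_sum _ _ _ (fun p _ => hp p)
    have hcard : (bxF (k : ℤ)).card = (2 * k + 1) * (2 * k + 1) := by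
      rw [bxF, Finset.card_product, Int.card_Icc]
      have : ((k : ℤ) + 1 - -(k : ℤ)).toNat = 2 * k + 1 := by omega
      rw [this]
    have hb : (bdry K).card ≤ (2 * k + 1) * (4 * (2 * m + 3)) := by
      refine (bdry_card K).trans ?_
      have : (2 * K + 1).toNat ≤ (2 * k + 1) * (2 * m + 3) := by
        zify
        rw [Int.toNat_of_nonneg (by omega), hK]
        nlinarith [Int.natCast_nonneg k, Int.natCast_nonneg m]
      nlinarith
    have hall : ((2 * k + 1 : ℕ) : ENNReal) * (((2 * k + 1 : ℕ) : ENNReal) * κ)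
        ≤ ((2 * k + 1 : ℕ) : ENNReal) * ((4 * (2 * m + 3) : ℕ) : ENNReal) := by
      rw [← mul_assoc, ← Nat.cast_mul, ← Nat.cast_mul, ← hcard]
      exact (hlow.trans hsum).trans (by exact_mod_cast hb)
    exact (ENNReal.mul_le_mul_iff_right (by norm_cast) (by exact ENNReal.natCast_ne_top _)).1 hall
  obtain ⟨n, hn⟩ := ENNReal.exists_nat_mul_gt hκ0
    (ENNReal.natCast_ne_top (4 * (2 * m + 3)))
  have h1 := main n
  have h2 : (n : ENNReal) * κ ≤ ((2 * n + 1 : ℕ) : ENNReal) * κ := by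
    gcongr
    exact_mod_cast (by omega : n ≤ 2 * n + 1)
  exact absurd (hn.trans_le (h2.trans h1)) (lt_irrefl _)

end Perc

/-- Under the symmetric Bernoulli product measure on spin configurations on `ℤ²` (the
probability measure under which the spins are i.i.d. fair coin flips, characterized by
its cylinder probabilities), almost every configuration has all clusters finite. -/
theorem stmt8 (μ : Measure ((ℤ × ℤ) → Bool)) [IsProbabilityMeasure μ]
    (hμ : ∀ (F : Finset (ℤ × ℤ)) (η : (ℤ × ℤ) → Bool),
      μ {σ | ∀ x ∈ F, σ x = η x} = (1 / 2 : ENNReal) ^ F.card) :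
    ∀ᵐ σ ∂μ, ∀ x : ℤ × ℤ, (cluster σ x).Finite := by
  have h0 := Perc.inf_null μ hμ
  have h1 : ∀ᵐ σ ∂μ, σ ∉ Perc.inf := measure_eq_zero_iff_ae_notMem.1 h0
  have h2 := (Perc.map_neg μ hμ).quasiMeasurePreserving.ae h1
  filter_upwards [h1, h2] with σ hs1 hs2 x
  simp only [Perc.inf, Set.mem_ofPred_eq, not_exists, Set.not_infinite] at hs1 hs2
  cases hx : σ x
  · have := hs2 x
    simpa [Perc.Reach, Perc.spin, cluster, hx] using this
  · have := hs1 x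
    simpa [Perc.Reach, Perc.spin, cluster, hx] using this
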